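/- arXiv:1506.08742 — 4 statements merged into one kernel-verified Lean document; each statement's English description precedes it below -/
import Mathlib

section
/- Let T : [−1,1] → ℝ be continuously differentiable. Then for every integer s ≥ 0 the series ∑_{r=s+1}^{∞} ⟨J_{r,−1/2}, T⟩_{−1/2} converges, and its sum equals ⟨J_{s,1/2}, T(1) − T⟩_{−1/2}, where T(1) − T denotes the function x ↦ T(1) − T(x). -/
open MeasureTheory Real

/-- Chebyshev polynomials of the second (`α = 1/2`) and third (`α = -1/2`) kind. -/
noncomputable def chebJ (α : ℝ) : ℕ → ℝ → ℝ
  | 0, _ => 1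
  | 1, x => if α = 1 / 2 then 2 * x else 2 * x - 1
  | n + 2, x => 2 * x * chebJ α (n + 1) x - chebJ α n x

/-- The normalized inner product `⟨f,g⟩_α`. -/
noncomputable def innerJ (α : ℝ) (f g : ℝ → ℝ) : ℝ :=
  (2 : ℝ) ^ (α + 1 / 2) / Real.pi *
    ∫ x in (-1 : ℝ)..1, f x * g x * (1 - x) ^ α * (1 + x) ^ ((1 : ℝ) / 2)

/-- The cosine coefficient `(1 / π) ∫_0^π f (cos θ) cos (n θ) dθ`. -/
noncomputable def cosCoeff (f : ℝ → ℝ) (n : ℕ) : ℝ :=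
  1 / π * ∫ θ in (0 : ℝ)..π, f (cos θ) * cos (n * θ)

theorem summable_fourierCoeffOn_of_hasDerivAt {a b : ℝ} (hab : a < b) {f f' : ℝ → ℂ}
    (hf : ∀ x ∈ Set.uIcc a b, HasDerivAt f (f' x) x) (hf' : ContinuousOn f' (Set.Icc a b))
    (hper : f a = f b) : Summable (fourierCoeffOn hab f) := by
  have hint : IntervalIntegrable f' volume a b :=
    ContinuousOn.intervalIntegrable (by rwa [Set.uIcc_of_le hab.le])
  have hL2 : MemLp f' 2 (volume.restrict (Set.Ioc a b)) := by
    obtain ⟨C, hC⟩ := isCompact_Icc.exists_bound_of_continuousOn hf'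
    refine MemLp.of_bound hint.1.aestronglyMeasurable C ?_
    filter_upwards [ae_restrict_mem measurableSet_Ioc] with x hx
    exact hC x (Set.Ioc_subset_Icc_self hx)
  have hsq := (hasSum_sq_fourierCoeffOn hab hL2).summable
  have hinv : Summable fun n : ℤ => 1 / (n : ℝ) ^ 2 :=
    Real.summable_one_div_int_pow.mpr one_lt_two
  refine Summable.of_norm_bounded_eventually
    (g := fun n : ℤ => (b - a) * (1 / (n : ℝ) ^ 2 + ‖fourierCoeffOn hab f' n‖ ^ 2))
    ((hinv.add hsq).mul_left _) ?_
  filter_upwards [(Set.finite_singleton (0 : ℤ)).compl_mem_cofinite] with n hn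
  have hn : n ≠ 0 := by simpa using hn
  have hn' : 0 < |(n : ℝ)| := abs_pos.mpr (Int.cast_ne_zero.mpr hn)
  rw [fourierCoeffOn_of_hasDerivAt hab hn hf hint, hper, sub_self, mul_zero, zero_sub,
    ← Complex.ofReal_sub]
  simp only [norm_mul, norm_div, norm_neg, norm_one, Complex.norm_real, Complex.norm_I,
    Complex.norm_intCast, Complex.norm_ofNat, mul_one, Real.norm_eq_abs, abs_of_pos pi_pos,
    abs_of_pos (sub_pos.mpr hab)]
  set y := ‖fourierCoeffOn hab f' n‖
  have hy : 0 ≤ y := norm_nonneg _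
  have hle : 1 / (2 * π * |(n : ℝ)|) ≤ 1 / |(n : ℝ)| := by
    apply one_div_le_one_div_of_le hn'
    nlinarith [pi_gt_three]
  have hsqn : 1 / (n : ℝ) ^ 2 = (1 / |(n : ℝ)|) ^ 2 := by rw [div_pow, sq_abs, one_pow]
  have hba := sub_pos.mpr hab
  rw [hsqn]
  have hz : 0 ≤ 1 / |(n : ℝ)| := by positivity
  calc 1 / (2 * π * |(n : ℝ)|) * ((b - a) * y) ≤ 1 / |(n : ℝ)| * ((b - a) * y) := by gcongr
    _ = (b - a) * (1 / |(n : ℝ)| * y) := by ring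
    _ ≤ _ := by
      gcongr
      nlinarith [sq_nonneg (1 / |(n : ℝ)| - y), mul_nonneg hz hy]

theorem fourierCoeffOn_even {g : ℝ → ℝ} (hg : Continuous g) (heven : ∀ x, g (-x) = g x) (n : ℤ)
    (h : -π < π) :
    fourierCoeffOn h (fun x => (g x : ℂ)) n =
      ((1 / π * ∫ x in (0 : ℝ)..π, g x * cos (n * x) : ℝ) : ℂ) := by
  have hfour : ∀ x : ℝ, fourier (-n) (x : AddCircle (π - -π)) =
      Complex.cos (n * x) - Complex.sin (n * x) * Complex.I := by
    intro x
    have hpi : (π : ℂ) ≠ 0 := by exact_mod_cast pi_ne_zero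
    rw [fourier_coe_apply, show 2 * (π : ℂ) * Complex.I * ((-n : ℤ) : ℂ) * x / ((π - -π : ℝ) : ℂ)
      = (-(n * x)) * Complex.I by push_cast; field_simp; ring, Complex.exp_mul_I, Complex.cos_neg,
      Complex.sin_neg]
    ring
  rw [fourierCoeffOn_eq_integral]
  simp only [hfour]
  set F : ℝ → ℂ := fun x => (Complex.cos (n * x) - Complex.sin (n * x) * Complex.I) • (g x : ℂ)
    with hF
  have hFc : Continuous F := by fun_prop
  rw [← intervalIntegral.integral_add_adjacent_intervals (hFc.intervalIntegrable (-π) 0)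
    (hFc.intervalIntegrable 0 π)]
  have hneg := intervalIntegral.integral_comp_neg (a := 0) (b := π) F
  rw [neg_zero] at hneg
  have hFn : Continuous fun x => F (-x) := by fun_prop
  rw [← hneg, ← intervalIntegral.integral_add (hFn.intervalIntegrable 0 π)
    (hFc.intervalIntegrable 0 π)]
  have hsum : ∀ x, F (-x) + F x = ((2 * (g x * cos (n * x)) : ℝ) : ℂ) := by
    intro x
    simp only [hF, heven, smul_eq_mul]
    push_cast
    rw [mul_neg, Complex.cos_neg, Complex.sin_neg]
    ring
  simp only [hsum]
  rw [intervalIntegral.integral_ofReal, intervalIntegral.integral_const_mul, Complex.real_smul,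
    ← Complex.ofReal_mul]
  congr 1
  field_simp
  ring

theorem hasSum_cosCoeff {T : ℝ → ℝ} (hT : ContDiffOn ℝ 1 T (Set.Icc (-1 : ℝ) 1)) :
    HasSum (fun n : ℕ => 2 * cosCoeff T n) (T 1 + cosCoeff T 0) := by
  have hmem : ∀ x : ℝ, cos x ∈ Set.Icc (-1 : ℝ) 1 := cos_mem_Icc
  set g : ℝ → ℝ := fun x => T (cos x) with hg_def
  set g' : ℝ → ℝ := fun x => derivWithin T (Set.Icc (-1) 1) (cos x) * -sin x
  have hg : Continuous g := hT.continuousOn.comp_continuous continuous_cos hmem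
  have hg' : Continuous g' :=
    ((hT.continuousOn_derivWithin (uniqueDiffOn_Icc (by norm_num)) le_rfl).comp_continuous
      continuous_cos hmem).mul continuous_sin.neg
  have hderiv : ∀ x, HasDerivAt g (g' x) x := fun x =>
    hasDerivWithinAt_univ.mp <|
      ((hT.differentiableOn one_ne_zero _ (hmem x)).hasDerivWithinAt).comp x
        (hasDerivAt_cos x).hasDerivWithinAt fun y _ => hmem y
  have hpi : -π < π := by linarith [pi_pos]
  have hfact : Fact (0 < π - -π) := ⟨by linarith⟩
  have hcoeff := fourierCoeffOn_even hg (fun x => by simp [hg_def])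
  have hsummable : Summable (fourierCoeffOn hpi fun x => (g x : ℂ)) :=
    summable_fourierCoeffOn_of_hasDerivAt hpi (f' := fun x => (g' x : ℂ))
      (fun x _ => (hderiv x).ofReal_comp) (by fun_prop) (by simp [hg_def])
  have hper : Function.Periodic (fun x => (g x : ℂ)) (π - -π) := fun x => by
    simp only [hg_def, show x + (π - -π) = x + 2 * π by ring, cos_add_two_pi]
  let G : C(AddCircle (π - -π), ℂ) :=
    ⟨hper.lift, continuous_coinduced_dom.mpr (by
      change Continuous fun x => (g x : ℂ)
      fun_prop)⟩
  have hG : ∀ n, fourierCoeff G n = fourierCoeffOn hpi (fun x => (g x : ℂ)) n := by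
    intro n
    rw [fourierCoeffOn_eq_integral, fourierCoeff_eq_intervalIntegral _ _ (-π),
      show -π + (π - -π) = π by ring]
    rfl
  have hsum := (has_pointwise_sum_fourier_series_of_summable
    (f := G) (by rwa [funext hG]) ((0 : ℝ) : AddCircle (π - -π))).nat_add_neg
  have hG0 : G ((0 : ℝ) : AddCircle (π - -π)) = (T 1 : ℂ) := by
    change (g 0 : ℂ) = T 1
    simp [hg_def]
  have hfour : ∀ n : ℤ, fourier n ((0 : ℝ) : AddCircle (π - -π)) = 1 := fun n => by
    rw [AddCircle.coe_zero, fourier_eval_zero]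
  simp only [hG, hG0, hfour, hcoeff, smul_eq_mul, mul_one] at hsum
  rw [← Complex.hasSum_ofReal]
  convert hsum using 1
  · ext n
    simp only [cosCoeff, hg_def]
    push_cast
    simp only [neg_mul, cos_neg]
    ring
  · simp [cosCoeff, hg_def]

theorem innerJ_neg_half_eq (p f : ℝ → ℝ) :
    innerJ (-(1 / 2)) p f =
      1 / π * ∫ θ in (0 : ℝ)..π, f (cos θ) * (p (cos θ) * (1 + cos θ)) := by
  rw [innerJ, ← Polynomial.Chebyshev.integral_measureT_eq_integral_cos
    (f := fun x => f x * (p x * (1 + x))), Polynomial.Chebyshev.integral_measureT]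
  have h0 : (2 : ℝ) ^ (-(1 / 2) + 1 / 2 : ℝ) = 1 := by norm_num
  rw [h0]
  congr 1
  refine intervalIntegral.integral_congr_Ioo_of_le (by norm_num) fun x hx => ?_
  have h1 : 0 < 1 - x := by linarith [hx.2]
  have h2 : 0 < 1 + x := by linarith [hx.1]
  rw [rpow_neg h1.le, ← sqrt_eq_rpow, ← sqrt_eq_rpow, sqrt_inv,
    show 1 - x ^ 2 = (1 - x) * (1 + x) by ring, sqrt_mul h1.le]
  have h3 := sqrt_pos.mpr h1
  have h4 := sqrt_pos.mpr h2
  field_simp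
  rw [sq_sqrt h2.le]

theorem chebJ_third_cos (n : ℕ) (θ : ℝ) :
    chebJ (-(1 / 2)) n (cos θ) * (1 + cos θ) = cos (n * θ) + cos ((n + 1 : ℕ) * θ) := by
  induction n using Nat.twoStepInduction with
  | zero => simp [chebJ]
  | one =>
    have : ¬(-(1 / 2) : ℝ) = 1 / 2 := by norm_num
    rw [chebJ, if_neg this]
    norm_num
    rw [cos_two_mul]
    ring
  | more n h0 h1 =>
    have key : ∀ m : ℕ, cos ((m + 2 : ℕ) * θ) = 2 * cos θ * cos ((m + 1 : ℕ) * θ) - cos (m * θ) := by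
      intro m
      have h := cos_add_cos ((m + 2 : ℕ) * θ) (m * θ)
      rw [show (((m + 2 : ℕ) : ℝ) * θ + m * θ) / 2 = (m + 1 : ℕ) * θ by push_cast; ring,
        show (((m + 2 : ℕ) : ℝ) * θ - m * θ) / 2 = θ by push_cast; ring] at h
      linarith
    rw [chebJ, key n, show n + 2 + 1 = (n + 1) + 2 by ring, key (n + 1)]
    linear_combination 2 * cos θ * h1 - h0

theorem chebJ_second_succ (n : ℕ) (x : ℝ) :
    chebJ (1 / 2) (n + 1) x = chebJ (1 / 2) n x + chebJ (-(1 / 2)) (n + 1) x := by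
  have hne : ¬(-(1 / 2) : ℝ) = 1 / 2 := by norm_num
  induction n using Nat.twoStepInduction with
  | zero => rw [zero_add, chebJ, chebJ, chebJ, if_pos rfl, if_neg hne]; ring
  | one => simp only [chebJ, if_pos, if_neg hne]; ring
  | more n h0 h1 =>
    have hrec : ∀ α m, chebJ α (m + 2) x = 2 * x * chebJ α (m + 1) x - chebJ α m x :=
      fun _ _ => rfl
    linear_combination hrec (1 / 2) (n + 1) - hrec (1 / 2) n - hrec (-(1 / 2)) (n + 1) +
      2 * x * h1 - h0

theorem intervalIntegrable_cosCoeff {f : ℝ → ℝ} (hf : ContinuousOn f (Set.Icc (-1) 1)) (n : ℕ) :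
    IntervalIntegrable (fun θ => f (cos θ) * cos (n * θ)) volume 0 π :=
  ((hf.comp_continuous continuous_cos cos_mem_Icc).mul (by fun_prop)).intervalIntegrable _ _

theorem innerJ_third {f : ℝ → ℝ} (hf : ContinuousOn f (Set.Icc (-1) 1)) (n : ℕ) :
    innerJ (-(1 / 2)) (chebJ (-(1 / 2)) n) f = cosCoeff f n + cosCoeff f (n + 1) := by
  rw [innerJ_neg_half_eq]
  simp only [chebJ_third_cos, mul_add (f _)]
  rw [intervalIntegral.integral_add (intervalIntegrable_cosCoeff hf n)
    (intervalIntegrable_cosCoeff hf (n + 1)), mul_add, cosCoeff, cosCoeff]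

theorem continuous_chebJ (α : ℝ) (n : ℕ) : Continuous (chebJ α n) := by
  induction n using Nat.twoStepInduction with
  | zero => exact continuous_const
  | one =>
    change Continuous fun x : ℝ => if α = 1 / 2 then 2 * x else 2 * x - 1
    split_ifs <;> fun_prop
  | more n h0 h1 => exact ((continuous_const.mul continuous_id).mul h1).sub h0

theorem innerJ_second {f : ℝ → ℝ} (hf : ContinuousOn f (Set.Icc (-1) 1)) (s : ℕ) :
    innerJ (-(1 / 2)) (chebJ (1 / 2) s) f =
      2 * ∑ n ∈ Finset.range (s + 1), cosCoeff f n - cosCoeff f 0 + cosCoeff f (s + 1) := by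
  induction s with
  | zero =>
    rw [show chebJ (1 / 2) 0 = chebJ (-(1 / 2)) 0 from rfl, innerJ_third hf]
    simp
    ring
  | succ s ih =>
    have hadd : innerJ (-(1 / 2)) (chebJ (1 / 2) (s + 1)) f =
        innerJ (-(1 / 2)) (chebJ (1 / 2) s) f +
          innerJ (-(1 / 2)) (chebJ (-(1 / 2)) (s + 1)) f := by
      have hfc := hf.comp_continuous continuous_cos cos_mem_Icc
      have hint : ∀ α n, IntervalIntegrable
          (fun θ => f (cos θ) * (chebJ α n (cos θ) * (1 + cos θ))) volume 0 π := fun α n =>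
        (hfc.mul (((continuous_chebJ α n).comp continuous_cos).mul
          (by fun_prop))).intervalIntegrable _ _
      simp only [innerJ_neg_half_eq, chebJ_second_succ]
      rw [← mul_add, ← intervalIntegral.integral_add (hint _ _) (hint _ _)]
      congr 2
      funext θ
      ring
    rw [hadd, ih, innerJ_third hf, Finset.sum_range_succ _ (s + 1)]
    ring

theorem cosCoeff_const_sub {f : ℝ → ℝ} (hf : ContinuousOn f (Set.Icc (-1) 1)) (c : ℝ) (n : ℕ) :
    cosCoeff (fun x => c - f x) n = (if n = 0 then c else 0) - cosCoeff f n := by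
  have hcos : Continuous fun θ : ℝ => c * cos (n * θ) := by fun_prop
  simp only [cosCoeff, sub_mul]
  rw [intervalIntegral.integral_sub (hcos.intervalIntegrable 0 π)
    (intervalIntegrable_cosCoeff hf n), intervalIntegral.integral_const_mul, mul_sub]
  congr 1
  split_ifs with hn
  · simp [hn]
    field_simp
  · rw [intervalIntegral.integral_comp_mul_left (fun x => cos x) (Nat.cast_ne_zero.mpr hn)]
    simp

/-- For `T` continuously differentiable on `[-1,1]`, the series
`∑_{r=s+1}^∞ ⟨J_{r,−1/2}, T⟩_{−1/2}` converges to `⟨J_{s,1/2}, T(1) − T⟩_{−1/2}`. -/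
theorem tail_sum_third_kind (T : ℝ → ℝ)
    (hT : ContDiffOn ℝ 1 T (Set.Icc (-1 : ℝ) 1)) (s : ℕ) :
    HasSum (fun r : ℕ => innerJ (-(1 / 2)) (chebJ (-(1 / 2)) (s + 1 + r)) T)
      (innerJ (-(1 / 2)) (chebJ (1 / 2) s) (fun x => T 1 - T x)) := by
  have hTc := hT.continuousOn
  have hsum := hasSum_cosCoeff hT
  have htail := fun k => (hasSum_nat_add_iff' (f := fun n : ℕ => 2 * cosCoeff T n) k).mpr hsum
  have h := ((htail (s + 1)).add (htail (s + 2))).div_const 2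
  convert! h using 1
  · funext r
    rw [innerJ_third hTc, show r + (s + 1) = s + 1 + r by ring,
      show r + (s + 2) = s + 1 + r + 1 by ring]
    ring
  · rw [innerJ_second (f := fun x => T 1 - T x) (continuousOn_const.sub hTc)]
    simp only [cosCoeff_const_sub hTc, Finset.sum_sub_distrib, Finset.sum_ite_eq',
      Finset.sum_range_succ _ (s + 1), ← Finset.mul_sum]
    simp
    ring
end

section
/- Determinantal form of interlacement: let n ≥ 1, λ ∈ 𝕁_n and μ ∈ 𝕁_{n+1}. Set λ̃_i := λ_i + r_n − i for 1 ≤ i ≤ r_n, and when n is even (so r_{n+1} = r_n + 1) additionally set λ̃_{r_{n+1}} := −1; set μ̃_j := μ_j + r_{n+1} − j for 1 ≤ j ≤ r_{n+1}. Then the indicator of interlacement satisfies 1_{(λ ≺ μ)} = 2^{−r_{n+1}}·det[φ_n(λ̃_i, μ̃_j)]_{i,j=1}^{r_{n+1}} if n is even, and 1_{(λ ≺ μ)} = det[φ_n(λ̃_i, μ̃_j)]_{i,j=1}^{r_{n+1}} if n is odd. -/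
open Classical

/-- `r_n = ⌊(n+1)/2⌋`. -/
def rr (n : ℕ) : ℕ := (n + 1) / 2

/-- `φ_n(s,t) = 2·1_{s<t}` if `n` even and `1_{s≤t}` if `n` odd, for integer arguments. -/
def phiStepZ (n : ℕ) (s t : ℤ) : ℝ :=
  if Even n then (if s < t then 2 else 0) else (if s ≤ t then 1 else 0)

/-- `λ̃_i := λ_i + r − i` (here `i` is 0-indexed, so this is `λ_i + r − 1 − i`). -/
def tildeZ {r : ℕ} (l : Fin r → ℕ) (i : Fin r) : ℤ :=
  (l i : ℤ) + (r : ℤ) - 1 - (i : ℤ)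

/-- Interlacement `λ ≺ μ`: `μ_1 ≥ λ_1 ≥ μ_2 ≥ λ_2 ≥ …`, entries with overflowing
indices read as `0`. -/
def interlaceN {r R : ℕ} (l : Fin r → ℕ) (m : Fin R → ℕ) : Prop :=
  (∀ i : Fin r, ∀ h : (i : ℕ) < R, l i ≤ m ⟨i, h⟩) ∧
  (∀ i : Fin r, ∀ h : (i : ℕ) + 1 < R, m ⟨(i : ℕ) + 1, h⟩ ≤ l i)

/-- The determinant of a square 0-1 matrix whose rows are initial segments of weakly
increasing lengths `c i`. -/
lemma det_initial_segments {N : ℕ} (c : Fin N → ℕ) (hc : Monotone c) (hN : ∀ i, c i ≤ N) :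
    Matrix.det (Matrix.of fun i j : Fin N => if (j : ℕ) < c i then (1 : ℝ) else 0) =
      if ∀ i, c i = i + 1 then 1 else 0 := by
  split_ifs with h
  · rw [Matrix.det_of_isLowerTriangular]
    · simp [h]
    · intro i j hij
      have hij : i < j := hij
      simp only [Matrix.of_apply, h]
      rw [if_neg (by omega)]
  · by_cases h0 : ∃ i, c i = 0
    · obtain ⟨i, hi⟩ := h0
      exact Matrix.det_eq_zero_of_row_eq_zero i (by simp [hi])
    · by_cases hinj : Function.Injective c
      · push Not at h0
        refine absurd (fun i => ?_) h
        let f : Fin N → Fin N := fun i => ⟨c i - 1, by have := hN i; have := h0 i; omega⟩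
        have hf : StrictMono f := by
          intro i j hij
          have h1 := hc.strictMono_of_injective hinj hij
          have h2 := h0 i
          simp only [f, Fin.mk_lt_mk]
          omega
        have hsurj : Function.Surjective f := Finite.surjective_of_injective hf.injective
        have hid : f = id := (hf.range_inj strictMono_id).1 (by simp [hsurj.range_eq])
        have h1 : c i - 1 = i := congrArg Fin.val (congrFun hid i)
        have h2 := h0 i
        omega
      · simp only [Function.Injective, not_forall] at hinj
        obtain ⟨i, j, hij, hne⟩ := hinj
        exact Matrix.det_zero_of_row_eq hne (by ext k; simp [hij])

/-- The determinant of the comparison matrix `1_{x_i ≤ y_j}` of two weakly decreasing sequences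
is the indicator of `y_1 ≥ x_1 > y_2 ≥ x_2 > …`. -/
lemma det_indicator_le {N : ℕ} {α : Type*} [LinearOrder α] (x y : Fin N → α)
    (hx : Antitone x) (hy : Antitone y) :
    Matrix.det (Matrix.of fun i j : Fin N => if x i ≤ y j then (1 : ℝ) else 0) =
      if ∀ i : Fin N, x i ≤ y i ∧ ∀ h : (i : ℕ) + 1 < N, y ⟨i + 1, h⟩ < x i then 1 else 0 := by
  let c : Fin N → ℕ := fun i => (Finset.univ.filter fun j => x i ≤ y j).card
  have hc : Monotone c := fun i j hij =>
    Finset.card_le_card (Finset.monotone_filter_right _ fun k _ hk => (hx hij).trans hk)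
  have hN : ∀ i, c i ≤ N := fun i => (Finset.card_le_univ _).trans_eq (Fintype.card_fin N)
  have key : ∀ i j, x i ≤ y j ↔ (j : ℕ) < c i := by
    intro i j
    constructor
    · intro h
      have hsub : Finset.Iic j ⊆ Finset.univ.filter fun j => x i ≤ y j := by
        intro k hk
        simpa using h.trans (hy (Finset.mem_Iic.1 hk))
      have := Finset.card_le_card hsub
      rw [Fin.card_Iic] at this
      exact this
    · intro h
      by_contra hlt
      have hsub : (Finset.univ.filter fun j => x i ≤ y j) ⊆ Finset.Iio j := by
        intro k hk
        rw [Finset.mem_Iio]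
        by_contra hjk
        exact hlt ((Finset.mem_filter.1 hk).2.trans (hy (not_lt.1 hjk)))
      have := Finset.card_le_card hsub
      rw [Fin.card_Iio] at this
      exact absurd h (not_lt.2 this)
  simp only [← not_le (a := x _), key]
  rw [det_initial_segments c hc hN]
  refine if_congr (forall_congr' fun i => ?_) rfl rfl
  have h1 := hN i
  have h2 := i.isLt
  constructor
  · intro h
    exact ⟨by omega, fun _ => by omega⟩
  · rintro ⟨h3, h4⟩
    by_cases h : (i : ℕ) + 1 < N
    · have := h4 h
      omega
    · omega

lemma tildeZ_antitone {r : ℕ} {l : Fin r → ℕ} (hl : Antitone l) : Antitone (tildeZ l) := by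
  intro i j hij
  have h1 := hl hij
  have h2 : (i : ℕ) ≤ j := hij
  simp only [tildeZ]
  omega

/-- The sequence `λ̃` stays weakly decreasing when it is continued by `-1`. -/
lemma tildeZ_extend_antitone {r : ℕ} {l : Fin r → ℕ} (hl : Antitone l) (R : ℕ) :
    Antitone fun i : Fin R => if h : (i : ℕ) < r then tildeZ l ⟨i, h⟩ else -1 := by
  intro i j hij
  have h2 : (i : ℕ) ≤ j := hij
  dsimp only
  split_ifs with hj hi hi
  · exact tildeZ_antitone hl hij
  · omega
  · simp only [tildeZ]
    omega
  · exact le_rfl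

/-- Determinantal form of the indicator of interlacement, with the virtual
value `λ̃_{r_{n+1}} := −1` when `n` is even. -/
theorem interlace_indicator_det (n : ℕ) (hn : 1 ≤ n)
    (lam : Fin (rr n) → ℕ) (hlam : Antitone lam)
    (mu : Fin (rr (n + 1)) → ℕ) (hmu : Antitone mu) :
    (if interlaceN lam mu then (1 : ℝ) else 0) =
      (if Even n then ((2 : ℝ) ^ rr (n + 1))⁻¹ else 1) *
        Matrix.det (Matrix.of fun i j : Fin (rr (n + 1)) =>
          phiStepZ n (if h : (i : ℕ) < rr n then tildeZ lam ⟨i, h⟩ else -1)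
            (tildeZ mu j)) := by
  set x : Fin (rr (n + 1)) → ℤ :=
    fun i => if h : (i : ℕ) < rr n then tildeZ lam ⟨i, h⟩ else -1 with hxdef
  have hx : Antitone x := tildeZ_extend_antitone hlam _
  have hy := tildeZ_antitone hmu
  by_cases he : Even n
  · have hr : rr (n + 1) = rr n + 1 := by
      obtain ⟨k, rfl⟩ := he
      simp only [rr]
      omega
    have hmat : (Matrix.of fun i j : Fin (rr (n + 1)) => phiStepZ n (x i) (tildeZ mu j)) =
        (2 : ℝ) • Matrix.of fun i j : Fin (rr (n + 1)) =>
          if x i + 1 ≤ tildeZ mu j then (1 : ℝ) else 0 := by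
      ext i j
      simp [phiStepZ, he]
    rw [hmat, Matrix.det_smul, det_indicator_le (fun i => x i + 1) _ (hx.add_const 1) hy,
      if_pos he, Fintype.card_fin, inv_mul_cancel_left₀ (by positivity)]
    refine if_congr ⟨fun h i => ?_, fun h => ⟨fun i hi => ?_, fun i hi => ?_⟩⟩ rfl rfl
    · by_cases hi : (i : ℕ) < rr n
      · have h1 := h.1 ⟨i, hi⟩ i.isLt
        have h2 := h.2 ⟨i, hi⟩
        simp only [hxdef, hi, dif_pos, tildeZ, Fin.eta] at h1 h2 ⊢
        refine ⟨by omega, fun h' => ?_⟩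
        have := h2 h'
        push_cast
        omega
      · simp only [hxdef, hi, dif_neg, not_false_eq_true, tildeZ]
        exact ⟨by omega, fun h' => by omega⟩
    · have h1 := (h ⟨i, hi⟩).1
      simp only [hxdef, i.isLt, dif_pos, tildeZ, Fin.eta] at h1
      omega
    · have h1 := (h ⟨i, by omega⟩).2 hi
      simp only [hxdef, i.isLt, dif_pos, tildeZ, Fin.eta] at h1
      push_cast at h1
      omega
  · have hr : rr (n + 1) = rr n := by
      obtain ⟨k, rfl⟩ := Nat.not_even_iff_odd.1 he
      simp only [rr]
      omega
    have hmat : (Matrix.of fun i j : Fin (rr (n + 1)) => phiStepZ n (x i) (tildeZ mu j)) =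
        Matrix.of fun i j : Fin (rr (n + 1)) =>
          if x i ≤ tildeZ mu j then (1 : ℝ) else 0 := by
      ext i j
      simp [phiStepZ, he]
    rw [hmat, det_indicator_le x _ hx hy, if_neg he, one_mul]
    refine if_congr ⟨fun h i => ?_, fun h => ⟨fun i hi => ?_, fun i hi => ?_⟩⟩ rfl rfl
    · have hi : (i : ℕ) < rr n := hr ▸ i.isLt
      have h1 := h.1 ⟨i, hi⟩ i.isLt
      have h2 := h.2 ⟨i, hi⟩
      simp only [hxdef, hi, dif_pos, tildeZ, Fin.eta] at h1 h2 ⊢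
      refine ⟨by omega, fun h' => ?_⟩
      have := h2 h'
      push_cast
      omega
    · have h1 := (h ⟨i, hi⟩).1
      simp only [hxdef, i.isLt, dif_pos, tildeZ, Fin.eta] at h1
      omega
    · have h1 := (h ⟨i, by omega⟩).2 hi
      simp only [hxdef, i.isLt, dif_pos, tildeZ, Fin.eta] at h1
      push_cast at h1
      omega
end

section
/- Consistency relation between consecutive symplectic levels: let E be infinitely differentiable on a neighborhood of [−1,1] and let r ≥ 1. For every partition μ = (μ_1 ≥ … ≥ μ_r ≥ 0) of length at most r, the sum over all partitions λ = (λ_1 ≥ … ≥ λ_r ≥ 0) with λ_1 ≥ μ_1 ≥ λ_2 ≥ μ_2 ≥ … ≥ λ_r ≥ μ_r of det[⟨J_{λ_j+r−j,1/2}, (x−1)^{r−i}·E⟩_{1/2}]_{i,j=1}^{r} converges absolutely and equals det[⟨J_{μ_j+r−j,−1/2}, (x−1)^{r−i}·E⟩_{−1/2}]_{i,j=1}^{r}. -/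
open MeasureTheory Real

theorem integral_eq_integral_sin_mul_comp_cos (F : ℝ → ℝ) :
    ∫ x in (-1 : ℝ)..1, F x = ∫ θ in (0 : ℝ)..π, sin θ * F (cos θ) := by
  rw [intervalIntegral.integral_of_le (by norm_num), intervalIntegral.integral_of_le pi_pos.le,
    ← integral_Icc_eq_integral_Ioc, ← integral_Icc_eq_integral_Ioc, ← bijOn_cos.image_eq,
    integral_image_eq_integral_abs_deriv_smul measurableSet_Icc
      (fun x _ => (hasDerivAt_cos x).hasDerivWithinAt) injOn_cos]
  refine setIntegral_congr_fun measurableSet_Icc fun θ hθ => ?_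
  simp [abs_of_nonneg (sin_nonneg_of_mem_Icc hθ)]

theorem chebJ_half_cos_mul_sin (θ : ℝ) :
    ∀ n : ℕ, chebJ (1 / 2) n (cos θ) * sin θ = sin ((n + 1) * θ)
  | 0 => by simp [chebJ]
  | 1 => by
    simp only [chebJ, if_true]
    rw [show ((1 : ℕ) + 1 : ℝ) * θ = 2 * θ by push_cast; ring, sin_two_mul]
    ring
  | n + 2 => by
    have h1 := chebJ_half_cos_mul_sin θ (n + 1)
    have h0 := chebJ_half_cos_mul_sin θ n
    rw [chebJ, sub_mul, mul_assoc, h1, h0,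
      show (((n + 2 : ℕ) : ℝ) + 1) * θ = (((n + 1 : ℕ) : ℝ) + 1) * θ + θ by push_cast; ring,
      show ((n : ℝ) + 1) * θ = (((n + 1 : ℕ) : ℝ) + 1) * θ - θ by push_cast; ring,
      sin_add, sin_sub]
    ring

theorem chebJ_neg_half_cos_mul_cos_half (θ : ℝ) :
    ∀ n : ℕ, chebJ (-(1 / 2)) n (cos θ) * cos (θ / 2) = cos ((n + 1 / 2) * θ)
  | 0 => by
    rw [chebJ, one_mul, Nat.cast_zero, zero_add, one_div_mul_eq_div]
  | 1 => by
    have h : ¬ (-(1 / 2) : ℝ) = 1 / 2 := by norm_num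
    simp only [chebJ, if_neg h]
    rw [show ((1 : ℕ) + 1 / 2 : ℝ) * θ = 3 * (θ / 2) by push_cast; ring, cos_three_mul,
      show cos θ = cos (2 * (θ / 2)) by ring_nf, cos_two_mul]
    ring
  | n + 2 => by
    have h1 := chebJ_neg_half_cos_mul_cos_half θ (n + 1)
    have h0 := chebJ_neg_half_cos_mul_cos_half θ n
    rw [chebJ, sub_mul, mul_assoc, h1, h0,
      show (((n + 2 : ℕ) : ℝ) + 1 / 2) * θ = (((n + 1 : ℕ) : ℝ) + 1 / 2) * θ + θ by
        push_cast; ring,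
      show ((n : ℝ) + 1 / 2) * θ = (((n + 1 : ℕ) : ℝ) + 1 / 2) * θ - θ by push_cast; ring,
      cos_add, cos_sub]
    ring

theorem sqrt_one_sub_cos {θ : ℝ} (h0 : 0 ≤ θ) (h1 : θ ≤ π) :
    √(1 - cos θ) = √2 * sin (θ / 2) := by
  have h : 1 - cos θ = 2 * sin (θ / 2) ^ 2 := by
    rw [show cos θ = cos (2 * (θ / 2)) by ring_nf, cos_two_mul, sin_sq]
    ring
  rw [h, sqrt_mul zero_le_two,
    sqrt_sq (sin_nonneg_of_nonneg_of_le_pi (by linarith) (by linarith))]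

theorem sqrt_one_add_cos' {θ : ℝ} (h0 : 0 ≤ θ) (h1 : θ ≤ π) :
    √(1 + cos θ) = √2 * cos (θ / 2) := by
  have h : 1 + cos θ = 2 * cos (θ / 2) ^ 2 := by
    rw [show cos θ = cos (2 * (θ / 2)) by ring_nf, cos_two_mul]
    ring
  rw [h, sqrt_mul zero_le_two,
    sqrt_sq (cos_nonneg_of_mem_Icc ⟨by linarith, by linarith⟩)]

theorem sin_eq_two_mul_sin_half_mul_cos_half (θ : ℝ) :
    sin θ = 2 * sin (θ / 2) * cos (θ / 2) := by
  rw [← sin_two_mul, mul_div_cancel₀ θ two_ne_zero]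

theorem innerJ_half_chebJ (n : ℕ) (f : ℝ → ℝ) :
    innerJ (1 / 2) (chebJ (1 / 2) n) f =
      2 / π * ∫ θ in (0 : ℝ)..π, sin θ * f (cos θ) * sin ((n + 1) * θ) := by
  rw [innerJ, integral_eq_integral_sin_mul_comp_cos, add_halves, rpow_one,
    intervalIntegral.integral_of_le pi_pos.le, intervalIntegral.integral_of_le pi_pos.le]
  congr 1
  refine setIntegral_congr_fun measurableSet_Ioc fun θ hθ => ?_
  have h2 : √(2 : ℝ) * √2 = 2 := mul_self_sqrt zero_le_two
  rw [← sqrt_eq_rpow, ← sqrt_eq_rpow, sqrt_one_sub_cos hθ.1.le hθ.2,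
    sqrt_one_add_cos' hθ.1.le hθ.2, ← chebJ_half_cos_mul_sin,
    sin_eq_two_mul_sin_half_mul_cos_half θ]
  linear_combination (2 * sin (θ / 2) ^ 2 * cos (θ / 2) ^ 2 *
    chebJ (1 / 2) n (cos θ) * f (cos θ)) * h2

theorem innerJ_neg_half_chebJ (n : ℕ) (f : ℝ → ℝ) :
    innerJ (-(1 / 2)) (chebJ (-(1 / 2)) n) f =
      2 / π * ∫ θ in (0 : ℝ)..π, cos (θ / 2) * f (cos θ) * cos ((n + 1 / 2) * θ) := by
  rw [innerJ, integral_eq_integral_sin_mul_comp_cos, neg_add_cancel, rpow_zero,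
    intervalIntegral.integral_of_le pi_pos.le, intervalIntegral.integral_of_le pi_pos.le,
    div_mul_eq_mul_div, div_mul_eq_mul_div, one_mul, ← integral_const_mul]
  congr 1
  refine setIntegral_congr_fun measurableSet_Ioc fun θ hθ => ?_
  have hs : 0 < sin (θ / 2) :=
    sin_pos_of_pos_of_lt_pi (by linarith [hθ.1]) (by linarith [hθ.2, pi_pos])
  have h2 : √(2 : ℝ) ≠ 0 := by positivity
  rw [rpow_neg (by linarith [cos_le_one θ]), ← sqrt_eq_rpow, ← sqrt_eq_rpow,
    sqrt_one_sub_cos hθ.1.le hθ.2, sqrt_one_add_cos' hθ.1.le hθ.2,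
    ← chebJ_neg_half_cos_mul_cos_half, sin_eq_two_mul_sin_half_mul_cos_half θ]
  field_simp

theorem hasDerivAt_sin_const_mul_div {a : ℝ} (ha : a ≠ 0) (θ : ℝ) :
    HasDerivAt (fun θ => sin (a * θ) / a) (cos (a * θ)) θ := by
  have h := (((hasDerivAt_id θ).const_mul a).sin).div_const a
  simpa [ha] using h

theorem hasDerivAt_neg_cos_const_mul_div {a : ℝ} (ha : a ≠ 0) (θ : ℝ) :
    HasDerivAt (fun θ => -cos (a * θ) / a) (sin (a * θ)) θ := by
  have h := (((hasDerivAt_id θ).const_mul a).cos).neg.div_const a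
  simpa [ha] using h

theorem exists_abs_integral_mul_cos_le {g : ℝ → ℝ} (hg : ContDiff ℝ 1 g) :
    ∃ C, ∀ a : ℝ, 0 < a → |∫ θ in (0 : ℝ)..π, g θ * cos (a * θ)| ≤ C / a := by
  have hg' : Continuous (deriv g) := hg.continuous_deriv le_rfl
  obtain ⟨K, hK⟩ := isCompact_uIcc (a := (0 : ℝ)) (b := π) |>.exists_bound_of_continuousOn
    hg'.continuousOn
  refine ⟨|g π| + K * π, fun a ha => ?_⟩
  rw [intervalIntegral.integral_mul_deriv_eq_deriv_mul
    (fun x _ => (hg.differentiable one_ne_zero x).hasDerivAt)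
    (fun x _ => hasDerivAt_sin_const_mul_div ha.ne' x) (hg'.intervalIntegrable _ _)
    ((by fun_prop : Continuous fun θ => cos (a * θ)).intervalIntegrable _ _)]
  have h1 : |g π * (sin (a * π) / a)| ≤ |g π| / a := by
    rw [abs_mul, abs_div, abs_of_pos ha, ← mul_div_assoc]
    gcongr
    exact mul_le_of_le_one_right (abs_nonneg _) (abs_sin_le_one _)
  have h2 : |∫ θ in (0 : ℝ)..π, deriv g θ * (sin (a * θ) / a)| ≤ K / a * π := by
    have := intervalIntegral.norm_integral_le_of_norm_le_const (a := 0) (b := π) (C := K / a)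
      (f := fun θ => deriv g θ * (sin (a * θ) / a)) fun θ hθ => by
        rw [norm_mul, norm_div, norm_eq_abs a, abs_of_pos ha, ← mul_div_assoc]
        gcongr
        exact (mul_le_of_le_one_right (norm_nonneg _) (abs_sin_le_one _)).trans
          (hK θ (Set.uIoc_subset_uIcc hθ))
    simpa [abs_of_pos pi_pos] using this
  simp only [mul_zero, sin_zero, zero_div, sub_zero]
  calc _ ≤ _ := abs_sub _ _
    _ ≤ |g π| / a + K / a * π := add_le_add h1 h2
    _ = _ := by ring

theorem exists_abs_integral_mul_sin_le {g : ℝ → ℝ} (hg : ContDiff ℝ 2 g) (h0 : g 0 = 0)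
    (hπ : g π = 0) :
    ∃ C, ∀ a : ℝ, 0 < a → |∫ θ in (0 : ℝ)..π, g θ * sin (a * θ)| ≤ C / a ^ 2 := by
  have hg' : ContDiff ℝ 1 (deriv g) := (contDiff_succ_iff_deriv.1 hg).2.2
  obtain ⟨C, hC⟩ := exists_abs_integral_mul_cos_le hg'
  refine ⟨C, fun a ha => ?_⟩
  have h := intervalIntegral.integral_mul_deriv_eq_deriv_mul (a := 0) (b := π)
    (fun x _ => (hg.differentiable two_ne_zero x).hasDerivAt)
    (fun x _ => hasDerivAt_neg_cos_const_mul_div ha.ne' x)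
    (hg'.continuous.intervalIntegrable _ _)
    ((by fun_prop : Continuous fun θ => sin (a * θ)).intervalIntegrable _ _)
  have h' : ∫ θ in (0 : ℝ)..π, deriv g θ * (-cos (a * θ) / a) =
      -(∫ θ in (0 : ℝ)..π, deriv g θ * cos (a * θ)) / a := by
    rw [← intervalIntegral.integral_neg, ← intervalIntegral.integral_div]
    congr 1
    ext θ
    ring
  rw [h, h', h0, hπ, zero_mul, zero_mul, sub_zero, zero_sub, neg_div, neg_neg, abs_div,
    abs_of_pos ha, sq, ← div_div]
  gcongr
  exact hC a ha

/-- The expansion coefficients of the second kind are the differences of those of the third. -/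
theorem innerJ_neg_half_sub_succ {f : ℝ → ℝ} (hf : Continuous fun θ => f (cos θ)) (n : ℕ) :
    innerJ (-(1 / 2)) (chebJ (-(1 / 2)) n) f - innerJ (-(1 / 2)) (chebJ (-(1 / 2)) (n + 1)) f =
      innerJ (1 / 2) (chebJ (1 / 2) n) f := by
  have h : ∀ c : ℝ, Continuous fun θ => cos (θ / 2) * f (cos θ) * cos (c * θ) := fun c =>
    ((continuous_cos.comp (continuous_id.div_const 2)).mul hf).mul
      (continuous_cos.comp (continuous_const_mul c))
  rw [innerJ_half_chebJ, innerJ_neg_half_chebJ, innerJ_neg_half_chebJ, ← mul_sub,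
    ← intervalIntegral.integral_sub
      ((h _).intervalIntegrable _ _)
      ((h _).intervalIntegrable _ _)]
  congr 2
  ext θ
  rw [show ((n : ℝ) + 1 / 2) * θ = (n + 1) * θ - θ / 2 by ring,
    show (((n + 1 : ℕ) : ℝ) + 1 / 2) * θ = (n + 1) * θ + θ / 2 by push_cast; ring,
    cos_sub, cos_add, sin_eq_two_mul_sin_half_mul_cos_half θ]
  ring

theorem summable_innerJ_half {f : ℝ → ℝ} (hf : ContDiff ℝ 2 fun θ => f (cos θ)) :
    Summable fun n => innerJ (1 / 2) (chebJ (1 / 2) n) f := by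
  obtain ⟨C, hC⟩ := exists_abs_integral_mul_sin_le (contDiff_sin.mul hf) (by simp) (by simp)
  simp only [innerJ_half_chebJ]
  refine Summable.mul_left _ (Summable.of_norm_bounded
    (g := fun n : ℕ => C * (1 / ((n + 1 : ℕ) : ℝ) ^ 2)) ?_ fun n => ?_)
  · exact ((summable_nat_add_iff 1).2 (summable_one_div_nat_pow.2 one_lt_two)).mul_left C
  · have := hC (n + 1) (by positivity)
    rw [norm_eq_abs, ← mul_one_div C] at *
    exact_mod_cast this

theorem tendsto_innerJ_neg_half {f : ℝ → ℝ} (hf : ContDiff ℝ 1 fun θ => f (cos θ)) :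
    Filter.Tendsto (fun n => innerJ (-(1 / 2)) (chebJ (-(1 / 2)) n) f) Filter.atTop (nhds 0) := by
  obtain ⟨C, hC⟩ := exists_abs_integral_mul_cos_le
    (g := fun θ => cos (θ / 2) * f (cos θ)) ((contDiff_cos.comp (contDiff_id.div_const 2)).mul hf)
  simp only [innerJ_neg_half_chebJ]
  have h : Filter.Tendsto (fun n : ℕ => C / ((n : ℝ) + 1 / 2)) Filter.atTop (nhds 0) :=
    (Filter.tendsto_atTop_add_const_right _ _ tendsto_natCast_atTop_atTop).const_div_atTop C
  simpa using (squeeze_zero_norm (fun n : ℕ => hC (n + 1 / 2) (by positivity)) h).const_mul (2 / π)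

theorem hasSum_innerJ_half {f : ℝ → ℝ} (hf : ContDiff ℝ 2 fun θ => f (cos θ)) (m : ℕ) :
    HasSum (fun k => innerJ (1 / 2) (chebJ (1 / 2) (k + m)) f)
      (innerJ (-(1 / 2)) (chebJ (-(1 / 2)) m) f) := by
  rw [((summable_nat_add_iff m).2 (summable_innerJ_half hf)).hasSum_iff_tendsto_nat]
  have h : ∀ n, ∑ k ∈ Finset.range n, innerJ (1 / 2) (chebJ (1 / 2) (k + m)) f =
      innerJ (-(1 / 2)) (chebJ (-(1 / 2)) m) f -
        innerJ (-(1 / 2)) (chebJ (-(1 / 2)) (n + m)) f := fun n => by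
    induction n with
    | zero => simp
    | succ n ih =>
      rw [Finset.sum_range_succ, ih, ← innerJ_neg_half_sub_succ hf.continuous, add_right_comm]
      ring
  simp only [h]
  simpa using ((Filter.tendsto_add_atTop_iff_nat m).2
    (tendsto_innerJ_neg_half (hf.of_le one_le_two))).const_sub
      (innerJ (-(1 / 2)) (chebJ (-(1 / 2)) m) f)

theorem hasSum_mul_of_real {ι κ : Type*} {f : ι → ℝ} {g : κ → ℝ} {s t : ℝ} (hf : HasSum f s)
    (hg : HasSum g t) : HasSum (fun x : ι × κ => f x.1 * g x.2) (s * t) :=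
  hf.mul hg (summable_mul_of_summable_norm hf.summable.norm hg.summable.norm)

theorem hasSum_pi_prod {n : ℕ} {b : Fin n → ℕ → ℝ} {s : Fin n → ℝ}
    (h : ∀ j, HasSum (b j) (s j)) :
    HasSum (fun l : Fin n → ℕ => ∏ j, b j (l j)) (∏ j, s j) := by
  induction n with
  | zero => simp
  | succ n ih =>
    have ih : HasSum (fun l : Fin n → ℕ => ∏ j, b j.succ (l j)) (∏ j : Fin n, s j.succ) :=
      ih fun j => h j.succ
    have hmul := hasSum_mul_of_real (h 0) ih
    rw [← (Fin.consEquiv fun _ : Fin (n + 1) => ℕ).hasSum_iff, Fin.prod_univ_succ]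
    refine hmul.congr_fun fun x => ?_
    simp [Fin.consEquiv, Fin.prod_univ_succ]

theorem hasSum_det_of_forall_entry {n : ℕ} {b : Fin n → Fin n → ℕ → ℝ}
    {s : Fin n → Fin n → ℝ} (h : ∀ i j, HasSum (b i j) (s i j)) :
    HasSum (fun l : Fin n → ℕ => Matrix.det (Matrix.of fun i j => b i j (l j)))
      (Matrix.det (Matrix.of s)) := by
  simp only [Matrix.det_apply, Matrix.of_apply]
  exact hasSum_sum fun σ _ => (hasSum_pi_prod fun j => h (σ j) j).const_smul _

/-- Summation over a product of sets of columns, one summation variable for each column. -/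
theorem hasSum_det_subtype {n : ℕ} {S : Fin n → Set ℕ} {b : Fin n → Fin n → ℕ → ℝ}
    {s : Fin n → Fin n → ℝ} (h : ∀ i j, HasSum ((S j).indicator (b i j)) (s i j))
    {T : Set (Fin n → ℕ)} (hT : ∀ l, l ∈ T ↔ ∀ j, l j ∈ S j) :
    HasSum (fun l : T => Matrix.det (Matrix.of fun i j => b i j (l.1 j)))
      (Matrix.det (Matrix.of s)) := by
  refine (hasSum_subtype_iff_indicator (f := fun l : Fin n → ℕ => Matrix.det
    (Matrix.of fun i j => b i j (l j)))).2 ?_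
  convert! hasSum_det_of_forall_entry h using 2 with l
  by_cases hl : l ∈ T
  · simp only [Set.indicator_of_mem hl, Set.indicator_of_mem ((hT l).1 hl _)]
  · rw [Set.indicator_of_notMem hl]
    obtain ⟨j, hj⟩ := not_forall.1 (mt (hT l).2 hl)
    exact (Matrix.det_eq_zero_of_column_eq_zero j fun i => Set.indicator_of_notMem hj _).symm

theorem hasSum_indicator_Ici {a A : ℕ → ℝ} (h : ∀ m, HasSum (fun k => a (k + m)) (A m))
    (p c : ℕ) : HasSum ((Set.Ici p).indicator fun l => a (l + c)) (A (p + c)) := by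
  rw [← hasSum_nat_add_iff' p, Finset.sum_eq_zero fun i hi =>
    Set.indicator_of_notMem (by simpa using hi) _, sub_zero]
  simpa [add_assoc] using h (p + c)

theorem hasSum_indicator_Ico {a A : ℕ → ℝ} (h : ∀ m, HasSum (fun k => a (k + m)) (A m))
    {p q : ℕ} (hpq : p ≤ q) (c : ℕ) :
    HasSum ((Set.Ico p q).indicator fun l => a (l + c)) (A (p + c) - A (q + c)) := by
  convert! (hasSum_indicator_Ici h p c).sub (hasSum_indicator_Ici h q c) using 2 with l
  simp only [Set.indicator_apply, Set.mem_Ico, Set.mem_Ici]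
  split_ifs <;> first | omega | simp

/-- Summing columns of a determinant over partitions interlacing with `μ`, when the entries are
differences of a sequence tending to zero. -/
theorem hasSum_det_interlacing {n : ℕ} {a A : Fin (n + 1) → ℕ → ℝ}
    (h : ∀ i m, HasSum (fun k => a i (k + m)) (A i m)) {μ : Fin (n + 1) → ℕ} (hμ : Antitone μ) :
    HasSum
      (fun lam : { l : Fin (n + 1) → ℕ // Antitone l ∧ (∀ i, μ i ≤ l i) ∧
          ∀ i : Fin (n + 1), ∀ h : (i : ℕ) + 1 < n + 1, l ⟨(i : ℕ) + 1, h⟩ ≤ μ i } =>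
        Matrix.det (Matrix.of fun i j : Fin (n + 1) => a i (lam.1 j + (n - (j : ℕ)))))
      (Matrix.det (Matrix.of fun i j : Fin (n + 1) => A i (μ j + (n - (j : ℕ))))) := by
  let S : Fin (n + 1) → Set ℕ :=
    Fin.cons (Set.Ici (μ 0)) fun j => Set.Ico (μ j.succ) (μ j.castSucc + 1)
  let s : Fin (n + 1) → Fin (n + 1) → ℝ := fun i => Fin.cons (A i (μ 0 + n)) fun j =>
    A i (μ j.succ + (n - (j + 1))) - A i (μ j.castSucc + (n - j))
  have hs : ∀ i j, HasSum ((S j).indicator fun l => a i (l + (n - (j : ℕ)))) (s i j) := by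
    intro i j
    cases j using Fin.cases with
    | zero => exact hasSum_indicator_Ici (h i) (μ 0) n
    | succ j =>
      have := hasSum_indicator_Ico (h i) (p := μ j.succ) (q := μ j.castSucc + 1)
        ((hμ (Fin.castSucc_lt_succ).le).trans (Nat.le_succ _)) (n - (j + 1))
      rwa [show μ j.castSucc + 1 + (n - ((j : ℕ) + 1)) = μ j.castSucc + (n - j) by omega] at this
  convert! hasSum_det_subtype hs (T := { l | Antitone l ∧ (∀ i, μ i ≤ l i) ∧
    ∀ i : Fin (n + 1), ∀ h : (i : ℕ) + 1 < n + 1, l ⟨(i : ℕ) + 1, h⟩ ≤ μ i }) ?_ using 1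
  · refine (Matrix.det_eq_of_forall_col_eq_smul_add_pred (fun _ => 1) (fun i => ?_)
      fun i j => ?_)
    · simp [s]
    · simp [s]
  · intro l
    simp only [Set.mem_ofPred_eq]
    constructor
    · rintro ⟨-, h1, h2⟩ j
      cases j using Fin.cases with
      | zero => exact h1 0
      | succ j => exact ⟨h1 _, Nat.lt_succ_of_le (h2 j.castSucc (by simp))⟩
    · intro hl
      have h1 : ∀ j, μ j ≤ l j := fun j => by
        cases j using Fin.cases with
        | zero => exact hl 0
        | succ j => exact (hl j.succ).1
      have h2 : ∀ j : Fin n, l j.succ ≤ μ j.castSucc := fun j => Nat.le_of_lt_succ (hl j.succ).2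
      exact ⟨Fin.antitone_iff_succ_le.2 fun j => (h2 j).trans (h1 _), h1,
        fun i hi => h2 ⟨i, by omega⟩⟩

/-- Consistency relation between consecutive symplectic levels: summing
`det[⟨J_{λ_j+r−j,1/2},(x−1)^{r−i}E⟩_{1/2}]` over all partitions `λ` of length at
most `r` with `λ_1 ≥ μ_1 ≥ λ_2 ≥ μ_2 ≥ … ≥ λ_r ≥ μ_r` gives
`det[⟨J_{μ_j+r−j,−1/2},(x−1)^{r−i}E⟩_{−1/2}]`. -/
theorem consistency_relation (E : ℝ → ℝ) (U : Set ℝ) (hU : IsOpen U)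
    (hsub : Set.Icc (-1 : ℝ) 1 ⊆ U) (hE : ContDiffOn ℝ (⊤ : ℕ∞) E U)
    (r : ℕ) (hr : 1 ≤ r) (μ : Fin r → ℕ) (hμ : Antitone μ) :
    HasSum
      (fun lam : { l : Fin r → ℕ // Antitone l ∧ (∀ i, μ i ≤ l i) ∧
          ∀ i : Fin r, ∀ h : (i : ℕ) + 1 < r, l ⟨(i : ℕ) + 1, h⟩ ≤ μ i } =>
        Matrix.det (Matrix.of fun i j : Fin r =>
          innerJ (1 / 2) (chebJ (1 / 2) (lam.1 j + (r - 1 - (j : ℕ))))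
            (fun x => (x - 1) ^ (r - 1 - (i : ℕ)) * E x)))
      (Matrix.det (Matrix.of fun i j : Fin r =>
        innerJ (-(1 / 2)) (chebJ (-(1 / 2)) (μ j + (r - 1 - (j : ℕ))))
          (fun x => (x - 1) ^ (r - 1 - (i : ℕ)) * E x))) := by
  obtain ⟨n, rfl⟩ := Nat.exists_eq_add_of_le' hr
  simp only [Nat.add_sub_cancel]
  refine hasSum_det_interlacing
    (a := fun i m => innerJ (1 / 2) (chebJ (1 / 2) m) fun x => (x - 1) ^ (n - (i : ℕ)) * E x)
    (A := fun i m =>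
      innerJ (-(1 / 2)) (chebJ (-(1 / 2)) m) fun x => (x - 1) ^ (n - (i : ℕ)) * E x)
    (fun i m => hasSum_innerJ_half ?_ m) hμ
  have hEcos : ContDiff ℝ 2 fun θ => E (cos θ) :=
    contDiff_iff_contDiffAt.2 fun θ => ((hE.contDiffAt
      (hU.mem_nhds (hsub ⟨neg_one_le_cos θ, cos_le_one θ⟩))).of_le
        (WithTop.coe_le_coe.2 le_top)).comp θ contDiff_cos.contDiffAt
  exact ((contDiff_cos.sub contDiff_const).pow _).mul hEcos
end

section
/- The symplectic Plancherel measures are probability measures (unit mass): let γ ≥ 0 and E(x) := e^{γ(x−1)}. Then for every n ≥ 1, the sum over all λ ∈ 𝕁_n of 2^{r_n(r_n−1)/2} · det[⟨J_{λ̃_j,α_n}, (x−1)^{r_n−i}·E⟩_{α_n}]_{i,j=1}^{r_n} · dim_n λ converges absolutely and equals 1. -/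
open MeasureTheory Real

/-- `α_n = 1/2` if `n` even, `-1/2` if `n` odd. -/
noncomputable def alph (n : ℕ) : ℝ := if Even n then 1 / 2 else -(1 / 2)

/-- `dim_n λ`: the symplectic dimension of `λ ∈ 𝕁_n` (Weyl dimension formula for
`n` even; the intermediate formula for `n` odd).  Here, with 0-indexed `i`,
`l_i = λ_i + r − i` and `m_i = r − i`. -/
noncomputable def dimSp (n : ℕ) (lam : Fin (rr n) → ℕ) : ℝ :=
  let r : ℕ := rr n
  let L : Fin r → ℝ := fun i => (lam i : ℝ) + (r : ℝ) - (i : ℕ)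
  let M : Fin r → ℝ := fun i => (r : ℝ) - (i : ℕ)
  if Even n then
    (∏ i : Fin r, ∏ j ∈ Finset.Ioi i, ((L i) ^ 2 - (L j) ^ 2) / ((M i) ^ 2 - (M j) ^ 2)) *
      ∏ i : Fin r, L i / M i
  else
    ∏ i : Fin r, ∏ j ∈ Finset.Ioi i,
      ((L i - 1 / 2) ^ 2 - (L j - 1 / 2) ^ 2) / ((M i - 1 / 2) ^ 2 - (M j - 1 / 2) ^ 2)

theorem hasSum_pi_prod_s9 {r : ℕ} {ι : Type*} (f : Fin r → ι → ℝ) (s : Fin r → ℝ)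
    (h : ∀ i, HasSum (f i) (s i)) :
    HasSum (fun κ : Fin r → ι => ∏ i, f i (κ i)) (∏ i, s i) := by
  induction r with
  | zero => simp
  | succ r ih =>
    have ih' := ih (fun i => f i.succ) (fun i => s i.succ) fun i => h i.succ
    have hs : Summable fun x : ι × (Fin r → ι) => f 0 x.1 * ∏ i, f (Fin.succ i) (x.2 i) :=
      summable_mul_of_summable_norm (f := f 0) (g := fun κ : Fin r → ι => ∏ i, f (Fin.succ i) (κ i))
        (h 0).summable.abs ih'.summable.abs
    have hmul := (h 0).mul ih' hs
    rw [Fin.prod_univ_succ, ← (Fin.consEquiv fun _ : Fin (r + 1) => ι).hasSum_iff]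
    convert! hmul using 2 with x
    simp [Fin.consEquiv, Fin.prod_univ_succ]

theorem hasSum_prod_mul_det {r : ℕ} {ι : Type*} (A B : Fin r → ι → ℝ) (S : Fin r → Fin r → ℝ)
    (h : ∀ i m, HasSum (fun k => A i k * B m k) (S i m)) :
    HasSum (fun κ : Fin r → ι => (∏ m, B m (κ m)) * Matrix.det (Matrix.of fun i j => A i (κ j)))
      (Matrix.det (Matrix.of S)) := by
  simp only [Matrix.det_apply', Finset.mul_sum]
  refine hasSum_sum fun σ _ => ?_
  convert! (hasSum_pi_prod_s9 (fun m k => A (σ m) k * B m k) _ fun m => h (σ m) m).mul_left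
    ((Equiv.Perm.sign σ : ℤ) : ℝ) using 2 with κ
  simp only [Matrix.of_apply, Finset.prod_mul_distrib]
  ring

theorem sum_perm_prod_mul_det {r : ℕ} {ι : Type*} (A B : Fin r → ι → ℝ) (κ : Fin r → ι) :
    ∑ σ : Equiv.Perm (Fin r),
      (∏ m, B m (κ (σ m))) * Matrix.det (Matrix.of fun i j => A i (κ (σ j))) =
    Matrix.det (Matrix.of fun i j => A i (κ j)) * Matrix.det (Matrix.of fun i j => B i (κ j)) := by
  rw [← Matrix.det_transpose (Matrix.of fun i j => B i (κ j)), Matrix.det_apply' (Matrix.transpose _),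
    Finset.mul_sum]
  refine Finset.sum_congr rfl fun σ _ => ?_
  have := Matrix.det_permute' σ (Matrix.of fun i j => A i (κ j))
  simp only [Matrix.submatrix, id, Matrix.of_apply] at this
  rw [this]
  simp only [Matrix.transpose_apply, Matrix.of_apply]
  ring

/-- The strictly decreasing sequence `λ_j + (r - 1 - j)` attached to `λ`. -/
def staircase {r : ℕ} (l : Fin r → ℕ) (j : Fin r) : ℕ := l j + (r - 1 - (j : ℕ))

theorem staircase_strictAnti {r : ℕ} {l : Fin r → ℕ} (hl : Antitone l) :
    StrictAnti (staircase l) := by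
  intro i j hij
  have h1 := hl hij.le
  have h2 : (i : ℕ) < j := hij
  have h3 := j.2
  simp only [staircase]
  omega

theorem exists_staircase_eq {r : ℕ} {κ : Fin r → ℕ} (hκ : StrictAnti κ) :
    ∃ l : Fin r → ℕ, Antitone l ∧ staircase l = κ := by
  have step : ∀ i j : Fin r, i ≤ j → κ j + (j - i : ℕ) ≤ κ i := by
    intro i j hij
    obtain ⟨d, hd⟩ : ∃ d : ℕ, (j : ℕ) = i + d := ⟨j - i, by have : (i : ℕ) ≤ j := hij; omega⟩
    induction d generalizing j with
    | zero => obtain rfl : j = i := Fin.ext (by simpa using hd)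
              simp
    | succ d ih =>
      have h1 := j.2
      have h2 := ih ⟨i + d, by omega⟩ (Fin.le_def.2 (by simp)) rfl
      have h3 : κ j < κ ⟨i + d, by omega⟩ := hκ (Fin.lt_def.2 (by simp; omega))
      simp at h2
      omega
  have low : ∀ i : Fin r, r - 1 - (i : ℕ) ≤ κ i := by
    intro i
    have h1 := i.2
    have := step i ⟨r - 1, by omega⟩ (Fin.le_def.2 (by simp; omega))
    simp at this
    omega
  refine ⟨fun i => κ i - (r - 1 - i), fun i j hij => ?_, funext fun i => ?_⟩
  · have h1 := step i j hij
    have h2 := low i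
    have h3 := low j
    have h4 : (i : ℕ) ≤ j := hij
    have h5 := j.2
    simp only
    omega
  · have := low i
    simp only [staircase]
    omega

theorem strictAnti_comp_perm_injective {r : ℕ} {κ κ' : Fin r → ℕ} {σ σ' : Equiv.Perm (Fin r)}
    (hκ : StrictAnti κ) (hκ' : StrictAnti κ') (h : κ ∘ σ = κ' ∘ σ') : κ = κ' ∧ σ = σ' := by
  have h1 : κ ∘ (σ * σ'⁻¹ : Equiv.Perm (Fin r)) = κ' := by
    funext i
    simpa using congrFun h (σ'⁻¹ i)
  have h2 : StrictMono (σ * σ'⁻¹ : Equiv.Perm (Fin r)) := by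
    intro i j hij
    have := hκ' hij
    rw [← h1] at this
    exact hκ.lt_iff_gt.1 this
  have h3 : (σ * σ'⁻¹ : Equiv.Perm (Fin r)) = 1 := by
    have hr := h2.range_inj (g := (id : Fin r → Fin r)) strictMono_id
    ext1 i
    exact congrFun (hr.1 (by simp)) i
  refine ⟨by rw [← h1, h3]; rfl, mul_inv_eq_one.1 h3⟩

theorem exists_perm_strictAnti {r : ℕ} {κ : Fin r → ℕ} (hκ : Function.Injective κ) :
    ∃ (κ' : Fin r → ℕ) (σ : Equiv.Perm (Fin r)), StrictAnti κ' ∧ κ' ∘ σ = κ := by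
  let τ : Equiv.Perm (Fin r) := Fin.revPerm.trans (Tuple.sort κ)
  refine ⟨κ ∘ τ, τ⁻¹, ?_, by funext i; simp⟩
  have hm : StrictMono (κ ∘ Tuple.sort κ) :=
    (Tuple.monotone_sort κ).strictMono_of_injective (hκ.comp (Tuple.sort κ).injective)
  intro i j hij
  exact hm (Fin.rev_lt_rev.2 hij)

/-- **Cauchy–Binet formula** for infinite sums, with the strictly decreasing sequences
parametrized by partitions. -/
theorem hasSum_det_mul_det {r : ℕ} (A B : Fin r → ℕ → ℝ) (S : Fin r → Fin r → ℝ)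
    (h : ∀ i m, HasSum (fun k => A i k * B m k) (S i m)) :
    HasSum (fun l : { l : Fin r → ℕ // Antitone l } =>
      Matrix.det (Matrix.of fun i j => A i (staircase l.1 j)) *
        Matrix.det (Matrix.of fun i j => B i (staircase l.1 j)))
      (Matrix.det (Matrix.of S)) := by
  let φ : { l : Fin r → ℕ // Antitone l } × Equiv.Perm (Fin r) → Fin r → ℕ :=
    fun p => staircase p.1.1 ∘ p.2
  have hφ : Function.Injective φ := by
    rintro ⟨l, σ⟩ ⟨l', σ'⟩ hll
    obtain ⟨h1, h2⟩ := strictAnti_comp_perm_injective (staircase_strictAnti l.2)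
      (staircase_strictAnti l'.2) hll
    have : l = l' := Subtype.ext (funext fun i => by
      have := congrFun h1 i
      simpa [staircase] using this)
    exact Prod.ext this h2
  have hsum := hasSum_prod_mul_det A B S h
  rw [← hφ.hasSum_iff] at hsum
  · refine hsum.prod_fiberwise fun l => ?_
    rw [← sum_perm_prod_mul_det]
    exact hasSum_fintype _
  · intro κ hκ
    have : ¬ Function.Injective κ := by
      intro hinj
      obtain ⟨κ', σ, h1, h2⟩ := exists_perm_strictAnti hinj
      obtain ⟨l, hl, h3⟩ := exists_staircase_eq h1
      exact hκ ⟨(⟨l, hl⟩, σ), by simp only [φ]; rw [h3, h2]⟩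
    obtain ⟨i, j, hij, hne⟩ := Function.not_injective_iff.1 this
    rw [Matrix.det_zero_of_column_eq hne fun m => by simp [hij], mul_zero]

/-- The values at `1` of the divided derivatives of the Chebyshev polynomials of the second
(`e = 1`) and third (`e = 0`) kind. -/
noncomputable def taylorJ (e m k : ℕ) : ℝ := 2 ^ m * ((k + e + m).choose (2 * m + e) : ℝ)

theorem taylorJ_eq_zero {e m k : ℕ} (h : k < m) : taylorJ e m k = 0 := by
  simp [taylorJ, Nat.choose_eq_zero_of_lt (show k + e + m < 2 * m + e by omega)]

theorem taylorJ_self (e m : ℕ) : taylorJ e m m = 2 ^ m := by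
  simp [taylorJ, show m + e + m = 2 * m + e by ring]

theorem abs_taylorJ_le (e m k : ℕ) : |taylorJ e m k| ≤ 2 ^ (e + 2 * m) * 2 ^ k := by
  have h : ((k + e + m).choose (2 * m + e) : ℝ) ≤ 2 ^ (k + e + m) := by
    exact_mod_cast Nat.choose_le_two_pow (k + e + m) (2 * m + e)
  rw [taylorJ, abs_of_nonneg (by positivity)]
  calc _ ≤ (2 : ℝ) ^ m * 2 ^ (k + e + m) := by gcongr
    _ = _ := by ring

theorem taylorJ_succ_zero (e m : ℕ) :
    (taylorJ e (m + 1) 1 - (1 + e) * taylorJ e (m + 1) 0) / 2 = taylorJ e m 0 := by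
  rcases m with _ | m
  · rw [taylorJ_self, taylorJ_eq_zero (by simp)]
    simp [taylorJ]
  · simp [taylorJ_eq_zero]

theorem taylorJ_succ (e m k : ℕ) :
    (taylorJ e (m + 1) (k + 2) + taylorJ e (m + 1) k) / 2 - taylorJ e (m + 1) (k + 1)
      = taylorJ e m (k + 1) := by
  simp only [taylorJ]
  have h1 : k + 2 + e + (m + 1) = (k + e + m + 1 + 1) + 1 := by ring
  have h2 : k + 1 + e + (m + 1) = (k + e + m + 1) + 1 := by ring
  have h3 : k + e + (m + 1) = k + e + m + 1 := by ring
  have h4 : 2 * (m + 1) + e = (2 * m + e) + 1 + 1 := by ring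
  have h5 : k + 1 + e + m = k + e + m + 1 := by ring
  rw [h1, h2, h3, h4, h5, Nat.choose_succ_succ (k + e + m + 1 + 1) (2 * m + e + 1),
    Nat.choose_succ_succ (k + e + m + 1) (2 * m + e + 1),
    Nat.choose_succ_succ (k + e + m + 1) (2 * m + e)]
  push_cast
  ring

/-- Summation by parts. -/
theorem sum_secondDiff_mul {c : ℝ} (f g : ℕ → ℝ) (K : ℕ) :
    ((f 1 - c * f 0) / 2 * g 0 + ∑ k ∈ Finset.range K,
        ((f (k + 2) + f k) / 2 - f (k + 1)) * g (k + 1)) -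
      (f 0 * ((g 1 - c * g 0) / 2) + ∑ k ∈ Finset.range K,
        f (k + 1) * ((g (k + 2) + g k) / 2 - g (k + 1))) =
    (f (K + 1) * g K - f K * g (K + 1)) / 2 := by
  induction K with
  | zero => simp; ring
  | succ K ih =>
    rw [Finset.sum_range_succ, Finset.sum_range_succ]
    linear_combination ih

open Polynomial in
/-- The monic polynomial `∏_{s < m} (X - (s + (1 + e)/2)²)`. -/
noncomputable def evenPoly (e m : ℕ) : ℝ[X] :=
  ∏ s ∈ Finset.range m, (X - C (((s : ℝ) + (1 + e) / 2) ^ 2))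

theorem evenPoly_monic (e m : ℕ) : (evenPoly e m).Monic :=
  Polynomial.monic_prod_of_monic _ _ fun _ _ => Polynomial.monic_X_sub_C _

theorem evenPoly_natDegree (e m : ℕ) : (evenPoly e m).natDegree = m := by
  rw [evenPoly, Polynomial.natDegree_prod_of_monic _ _ fun _ _ => Polynomial.monic_X_sub_C _]
  simp only [Polynomial.natDegree_X_sub_C, Finset.sum_const, Finset.card_range, smul_eq_mul,
    mul_one]

theorem taylorJ_eq_evenPoly {e : ℕ} (he : e ≤ 1) (m : ℕ) : ∃ c : ℝ, ∀ k : ℕ,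
    taylorJ e m k = c * ((k : ℝ) + 1) ^ e *
      (evenPoly e m).eval (((k : ℝ) + (1 + e) / 2) ^ 2) := by
  induction m with
  | zero =>
    refine ⟨1, fun k => ?_⟩
    interval_cases e <;> simp [taylorJ, evenPoly]
  | succ m ih =>
    obtain ⟨c, hc⟩ := ih
    refine ⟨c * 2 / ((2 * m + e + 1) * (2 * m + e + 2)), fun k => ?_⟩
    have key : taylorJ e (m + 1) k * ((2 * m + e + 1) * (2 * m + e + 2)) =
        2 * taylorJ e m k * (((k : ℝ) + (1 + e) / 2) ^ 2 - ((m : ℝ) + (1 + e) / 2) ^ 2) := by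
      rcases lt_or_ge k m with hk | hk
      · rw [taylorJ_eq_zero hk, taylorJ_eq_zero (by omega)]; simp
      · have h1 := Nat.add_one_mul_choose_eq (k + e + m) (2 * m + e + 1)
        have h2 := Nat.choose_succ_right_eq (k + e + m) (2 * m + e)
        have h3 : k + e + m - (2 * m + e) = k - m := by omega
        rw [h3] at h2
        have h1' : ((k : ℝ) + e + m + 1) * ((k + e + m).choose (2 * m + e + 1) : ℝ) =
          ((k + e + m + 1).choose (2 * m + e + 2) : ℝ) * (2 * m + e + 2) := by exact_mod_cast h1
        have h2' : ((k + e + m).choose (2 * m + e + 1) : ℝ) * (2 * m + e + 1) =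
          ((k + e + m).choose (2 * m + e) : ℝ) * (k - m) := by
          rw [← Nat.cast_sub hk]; exact_mod_cast h2
        simp only [taylorJ, show k + e + (m + 1) = k + e + m + 1 by ring,
          show 2 * (m + 1) + e = 2 * m + e + 2 by ring, pow_succ]
        linear_combination (-2 * 2 ^ m * (2 * m + e + 1 : ℝ)) * h1' +
          (2 * 2 ^ m * (k + e + m + 1 : ℝ)) * h2'
    have hev : (evenPoly e (m + 1)).eval (((k : ℝ) + (1 + e) / 2) ^ 2) =
        (evenPoly e m).eval (((k : ℝ) + (1 + e) / 2) ^ 2) *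
          (((k : ℝ) + (1 + e) / 2) ^ 2 - ((m : ℝ) + (1 + e) / 2) ^ 2) := by
      rw [evenPoly, Finset.prod_range_succ, Polynomial.eval_mul]
      simp [evenPoly]
    rw [hev]
    have hne : ((2 * m + e + 1 : ℝ) * (2 * m + e + 2)) ≠ 0 := by positivity
    rw [eq_div_of_mul_eq hne key, hc]
    field_simp

theorem exists_det_taylorJ_eq {e : ℕ} (he : e ≤ 1) (r : ℕ) : ∃ c : ℝ, ∀ κ : Fin r → ℕ,
    Matrix.det (Matrix.of fun i j : Fin r => taylorJ e (r - 1 - (i : ℕ)) (κ j)) =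
      c * ((∏ i : Fin r, ∏ j ∈ Finset.Ioi i,
        (((κ j : ℝ) + (1 + e) / 2) ^ 2 - ((κ i : ℝ) + (1 + e) / 2) ^ 2)) *
          ∏ j, ((κ j : ℝ) + 1) ^ e) := by
  choose c hc using taylorJ_eq_evenPoly he
  refine ⟨(Equiv.Perm.sign (Fin.revPerm : Equiv.Perm (Fin r)) : ℤ) * ∏ i : Fin r, c i,
    fun κ => ?_⟩
  rw [← Matrix.det_vandermonde, Matrix.det_eval_matrixOfPolynomials_eq_det_vandermonde _
    (fun i : Fin r => evenPoly e i) (fun i => evenPoly_natDegree e i) fun i => evenPoly_monic e i]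
  set V : Matrix (Fin r) (Fin r) ℝ := Matrix.of fun i j : Fin r =>
    (evenPoly e j).eval (((κ i : ℝ) + (1 + e) / 2) ^ 2) with hV
  have hM : (Matrix.of fun i j : Fin r => taylorJ e (r - 1 - (i : ℕ)) (κ j)) =
      Matrix.of fun i j : Fin r => c (Fin.rev i) * (Matrix.of fun i j : Fin r =>
        ((κ j : ℝ) + 1) ^ e * (V.transpose.submatrix Fin.revPerm id) i j) i j := by
    ext i j
    have : r - 1 - (i : ℕ) = Fin.rev i := by simp [Fin.val_rev]; omega
    simp [hV, this, hc, mul_assoc]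
  rw [hM, Matrix.det_mul_column, Matrix.det_mul_row, Matrix.det_permute, Matrix.det_transpose,
    ← Equiv.prod_comp Fin.revPerm fun i : Fin r => c i]
  simp only [Fin.revPerm_apply]
  ring

theorem det_taylorJ_staircase_zero (e r : ℕ) :
    Matrix.det (Matrix.of fun i j : Fin r => taylorJ e (r - 1 - (i : ℕ)) (r - 1 - (j : ℕ))) =
      2 ^ (r * (r - 1) / 2) := by
  rw [Matrix.det_of_isLowerTriangular]
  · simp only [Matrix.of_apply, taylorJ_self, Finset.prod_pow_eq_pow_sum]
    rw [Fin.sum_univ_eq_sum_range (fun i => r - 1 - i), Finset.sum_range_reflect (fun i => i),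
      Finset.sum_range_id]
  · intro i j hij
    have h1 : (i : ℕ) < j := hij
    have := j.2
    exact taylorJ_eq_zero (by omega)

/-- The function `θ ↦ cos kθ + (-1)^e cos((k + 1 + e)θ)`, which is the Chebyshev polynomial of the
second (`e = 1`) or third (`e = 0`) kind at `cos θ` times the orthogonality weight. -/
noncomputable def cosKernel (e k : ℕ) (θ : ℝ) : ℝ :=
  cos (k * θ) + (-1) ^ e * cos ((k + 1 + e) * θ)

theorem continuous_cosKernel (e k : ℕ) : Continuous (cosKernel e k) := by
  unfold cosKernel
  fun_prop

theorem abs_cosKernel_le (e k : ℕ) (θ : ℝ) : |cosKernel e k θ| ≤ 2 := by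
  refine (abs_add_le _ _).trans ?_
  have h1 := abs_cos_le_one (k * θ)
  have h2 := abs_cos_le_one ((k + 1 + e) * θ)
  rw [abs_mul, abs_pow, abs_neg, abs_one, one_pow, one_mul]
  linarith

theorem cosKernel_succ_succ (e k : ℕ) (θ : ℝ) :
    cosKernel e (k + 2) θ = 2 * cos θ * cosKernel e (k + 1) θ - cosKernel e k θ := by
  have h1 := cos_add ((k + 1) * θ) θ
  have h2 := cos_sub ((k + 1) * θ) θ
  have h3 := cos_add ((k + 1 + 1 + e) * θ) θ
  have h4 := cos_sub ((k + 1 + 1 + e) * θ) θ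
  simp only [cosKernel]
  push_cast
  rw [show (k + 2 : ℝ) * θ = (k + 1) * θ + θ by ring, show (k : ℝ) * θ = (k + 1) * θ - θ by ring,
    show (k + 2 + 1 + e : ℝ) * θ = (k + 1 + 1 + e) * θ + θ by ring,
    show (k + 1 + e : ℝ) * θ = (k + 1 + 1 + e) * θ - θ by ring, h1, h2, h3, h4]
  ring

theorem cosKernel_one {e : ℕ} (he : e ≤ 1) (θ : ℝ) :
    cosKernel e 1 θ = (2 * cos θ - 1 + e) * cosKernel e 0 θ := by
  interval_cases e
  · simp [cosKernel, show (1 + 1 : ℝ) * θ = 2 * θ by ring, cos_two_mul]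
    ring
  · simp [cosKernel, show (1 + 1 + 1 : ℝ) * θ = 3 * θ by ring,
      show (1 + 1 : ℝ) * θ = 2 * θ by ring, cos_two_mul, cos_three_mul]
    ring

theorem chebJ_cos_mul {e : ℕ} (he : e ≤ 1) (k : ℕ) (θ : ℝ) :
    chebJ (e - 1 / 2) k (cos θ) * cosKernel e 0 θ = cosKernel e k θ := by
  induction k using Nat.twoStepInduction with
  | zero => simp [chebJ]
  | one =>
    rw [cosKernel_one he]
    interval_cases e
    · norm_num [chebJ]
    · norm_num [chebJ]
  | more k ih0 ih1 =>
    rw [cosKernel_succ_succ, ← ih0, ← ih1, chebJ]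
    ring

/-- The inner product `⟨J_k, g⟩` written as an integral over the angle. -/
noncomputable def innerCos (e k : ℕ) (g : ℝ → ℝ) : ℝ :=
  π⁻¹ * ∫ θ in (0 : ℝ)..π, cosKernel e k θ * g (cos θ)

theorem weight_eq {e : ℕ} (he : e ≤ 1) {x : ℝ} (hx : x ∈ Set.uIcc (-1 : ℝ) 1) :
    (2 : ℝ) ^ e * ((1 - x) ^ ((e : ℝ) - 1 / 2) * (1 + x) ^ ((1 : ℝ) / 2)) =
      (1 + x) * (2 * (1 - x)) ^ e * √(1 - x ^ 2)⁻¹ := by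
  rw [Set.uIcc_of_le (by norm_num)] at hx
  have h0 : 0 ≤ 1 - x := by linarith [hx.2]
  have h1 : 0 ≤ 1 + x := by linarith [hx.1]
  rcases h0.eq_or_lt with h0' | h0'
  · have hx1 : x = 1 := by linarith
    subst hx1
    interval_cases e <;> norm_num
  have hp : (1 - x) ^ ((e : ℝ) - 1 / 2) = (1 - x) ^ e * (√(1 - x))⁻¹ := by
    rw [rpow_sub h0', rpow_natCast, ← sqrt_eq_rpow, div_eq_mul_inv]
  rw [hp, ← sqrt_eq_rpow, show 1 - x ^ 2 = (1 - x) * (1 + x) by ring, sqrt_inv, sqrt_mul h0,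
    mul_inv, mul_pow]
  have : √(1 + x) = (1 + x) * (√(1 + x))⁻¹ := by
    rcases h1.eq_or_lt with h1' | h1'
    · simp [← h1']
    · have := sqrt_pos.2 h1'
      field_simp
      exact sq_sqrt h1
  conv_lhs => rw [this]
  ring

theorem cosKernel_zero {e : ℕ} (he : e ≤ 1) (θ : ℝ) :
    cosKernel e 0 θ = (1 + cos θ) * (2 * (1 - cos θ)) ^ e := by
  interval_cases e
  · simp [cosKernel]
  · simp [cosKernel, show (1 + 1 : ℝ) * θ = 2 * θ by ring, cos_two_mul]
    ring

theorem innerJ_eq_innerCos {e : ℕ} (he : e ≤ 1) (k : ℕ) (g : ℝ → ℝ) :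
    innerJ (e - 1 / 2) (chebJ (e - 1 / 2) k) g = innerCos e k g := by
  have h := (Polynomial.Chebyshev.integral_measureT fun x =>
      chebJ (e - 1 / 2) k x * ((1 + x) * (2 * (1 - x)) ^ e) * g x).symm.trans
    Polynomial.Chebyshev.integral_measureT_eq_integral_cos
  simp only [← cosKernel_zero he, chebJ_cos_mul he] at h
  rw [innerJ, innerCos, ← h, sub_add_cancel, rpow_natCast, div_eq_inv_mul, mul_assoc,
    ← intervalIntegral.integral_const_mul]
  congr 1
  refine intervalIntegral.integral_congr fun x hx => ?_
  linear_combination chebJ (e - 1 / 2) k x * g x * weight_eq he hx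

theorem integral_cos_natCast_mul {m : ℕ} (hm : m ≠ 0) :
    ∫ θ in (0 : ℝ)..π, cos (m * θ) = 0 := by
  rw [intervalIntegral.integral_comp_mul_left (fun x => cos x) (Nat.cast_ne_zero.2 hm)]
  simp [sin_nat_mul_pi]

theorem innerCos_one (e k : ℕ) : innerCos e k (fun _ => 1) = if k = 0 then 1 else 0 := by
  have h : (∫ θ in (0 : ℝ)..π, cosKernel e k θ * 1) = ∫ θ in (0 : ℝ)..π, cos (k * θ) := by
    simp only [mul_one, cosKernel]
    rw [intervalIntegral.integral_add, intervalIntegral.integral_const_mul]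
    · have := integral_cos_natCast_mul (m := k + 1 + e) (by omega)
      push_cast at this
      rw [this, mul_zero, add_zero]
    · exact Continuous.intervalIntegrable (by fun_prop) _ _
    · exact Continuous.intervalIntegrable (by fun_prop) _ _
  rw [innerCos, h]
  split_ifs with hk
  · simp [hk, pi_ne_zero]
  · rw [integral_cos_natCast_mul hk, mul_zero]

theorem innerCos_mul_sub_one_zero {e : ℕ} (he : e ≤ 1) {g : ℝ → ℝ} (hg : Continuous g) :
    innerCos e 0 (fun x => (x - 1) * g x) =
      (innerCos e 1 g - (1 + e) * innerCos e 0 g) / 2 := by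
  have hc := continuous_cosKernel e
  have hi : ∀ k, IntervalIntegrable (fun θ => cosKernel e k θ * g (cos θ)) volume 0 π :=
    fun k => Continuous.intervalIntegrable (by have := hc k; fun_prop) _ _
  have h : (∫ θ in (0 : ℝ)..π, cosKernel e 0 θ * ((cos θ - 1) * g (cos θ))) =
      ∫ θ in (0 : ℝ)..π, (2⁻¹ * (cosKernel e 1 θ * g (cos θ)) -
        ((1 + e) / 2) * (cosKernel e 0 θ * g (cos θ))) := by
    congr 1
    funext θ
    rw [cosKernel_one he]
    ring
  simp only [innerCos]
  rw [h, intervalIntegral.integral_sub ((hi 1).const_mul _) ((hi 0).const_mul _),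
    intervalIntegral.integral_const_mul, intervalIntegral.integral_const_mul]
  ring

theorem innerCos_mul_sub_one_succ (e k : ℕ) {g : ℝ → ℝ} (hg : Continuous g) :
    innerCos e (k + 1) (fun x => (x - 1) * g x) =
      (innerCos e (k + 2) g + innerCos e k g) / 2 - innerCos e (k + 1) g := by
  have hc := continuous_cosKernel e
  have hi : ∀ k, IntervalIntegrable (fun θ => cosKernel e k θ * g (cos θ)) volume 0 π :=
    fun k => Continuous.intervalIntegrable (by have := hc k; fun_prop) _ _
  have h : (∫ θ in (0 : ℝ)..π, cosKernel e (k + 1) θ * ((cos θ - 1) * g (cos θ))) =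
      ∫ θ in (0 : ℝ)..π, (2⁻¹ * (cosKernel e (k + 2) θ * g (cos θ) +
        cosKernel e k θ * g (cos θ)) - cosKernel e (k + 1) θ * g (cos θ)) := by
    congr 1
    funext θ
    rw [cosKernel_succ_succ]
    ring
  simp only [innerCos]
  rw [h, intervalIntegral.integral_sub (((hi _).add (hi _)).const_mul _) (hi _),
    intervalIntegral.integral_const_mul, intervalIntegral.integral_add (hi _) (hi _)]
  ring

/-- The coefficient of the `k`-th Chebyshev polynomial in the expansion of `(x - 1)^N`. -/
noncomputable def powCoeff (e N k : ℕ) : ℝ := innerCos e k fun x => (x - 1) ^ N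

theorem powCoeff_zero (e k : ℕ) : powCoeff e 0 k = if k = 0 then 1 else 0 := by
  simpa [powCoeff] using innerCos_one e k

theorem powCoeff_succ_zero {e : ℕ} (he : e ≤ 1) (N : ℕ) :
    powCoeff e (N + 1) 0 = (powCoeff e N 1 - (1 + e) * powCoeff e N 0) / 2 := by
  simp only [powCoeff, pow_succ']
  exact innerCos_mul_sub_one_zero he (by fun_prop)

theorem powCoeff_succ_succ (e N k : ℕ) :
    powCoeff e (N + 1) (k + 1) =
      (powCoeff e N (k + 2) + powCoeff e N k) / 2 - powCoeff e N (k + 1) := by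
  simp only [powCoeff, pow_succ' _ N]
  exact innerCos_mul_sub_one_succ e k (by fun_prop)

theorem powCoeff_eq_zero (e : ℕ) {N k : ℕ} (h : N < k) : powCoeff e N k = 0 := by
  induction N generalizing k with
  | zero => rw [powCoeff_zero, if_neg (by omega)]
  | succ N ih =>
    obtain ⟨k, rfl⟩ : ∃ l, k = l + 1 := ⟨k - 1, by omega⟩
    rw [powCoeff_succ_succ, ih (by omega), ih (by omega), ih (by omega)]
    simp

theorem abs_cos_sub_one_le (θ : ℝ) : |cos θ - 1| ≤ 2 := by
  rw [abs_le]
  constructor <;> linarith [neg_one_le_cos θ, cos_le_one θ]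

theorem abs_powCoeff_le (e N k : ℕ) : |powCoeff e N k| ≤ 2 * 2 ^ N := by
  have h := intervalIntegral.norm_integral_le_of_norm_le_const (a := 0) (b := π)
    (C := 2 * 2 ^ N) (f := fun θ => cosKernel e k θ * (cos θ - 1) ^ N) fun θ _ => by
      rw [norm_mul, norm_pow]
      gcongr
      · exact abs_cosKernel_le e k θ
      · exact abs_cos_sub_one_le θ
  rw [sub_zero, abs_of_pos pi_pos, norm_eq_abs] at h
  rw [powCoeff, innerCos, abs_mul, abs_of_pos (inv_pos.2 pi_pos), inv_mul_le_iff₀ pi_pos,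
    mul_comm π]
  exact h

theorem hasSum_exp_mul_pow (γ y : ℝ) (p : ℕ) :
    HasSum (fun N : ℕ => γ ^ N / (N.factorial : ℝ) * y ^ (N + p)) (y ^ p * exp (γ * y)) := by
  have h := (NormedSpace.expSeries_div_hasSum_exp (γ * y)).mul_left (y ^ p)
  rw [← exp_eq_exp_ℝ] at h
  convert! h using 2 with N
  rw [mul_pow]
  ring

theorem hasSum_innerCos_exp {γ : ℝ} (hγ : 0 ≤ γ) (e p k : ℕ) :
    HasSum (fun N : ℕ => γ ^ N / (N.factorial : ℝ) * powCoeff e (N + p) k)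
      (innerCos e k fun x => (x - 1) ^ p * exp (γ * (x - 1))) := by
  have hc := continuous_cosKernel e k
  have h := intervalIntegral.hasSum_integral_of_dominated_convergence (μ := volume)
    (a := 0) (b := π)
    (F := fun N θ => cosKernel e k θ * (γ ^ N / (N.factorial : ℝ) * (cos θ - 1) ^ (N + p)))
    (f := fun θ => cosKernel e k θ * ((cos θ - 1) ^ p * exp (γ * (cos θ - 1))))
    (fun N _ => 2 * (γ ^ N / (N.factorial : ℝ) * 2 ^ (N + p)))
    (fun N => Continuous.aestronglyMeasurable (by fun_prop))
    (fun N => Filter.Eventually.of_forall fun θ _ => by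
      have h0 : 0 ≤ γ ^ N / (N.factorial : ℝ) := by positivity
      rw [norm_mul, norm_mul, norm_pow, norm_of_nonneg h0]
      gcongr
      · exact abs_cosKernel_le e k θ
      · exact abs_cos_sub_one_le θ)
    (Filter.Eventually.of_forall fun θ _ => (hasSum_exp_mul_pow γ 2 p).summable.mul_left 2)
    intervalIntegrable_const
    (Filter.Eventually.of_forall fun θ _ => (hasSum_exp_mul_pow γ _ p).mul_left _)
  convert! h.mul_left π⁻¹ using 2 with N
  rw [powCoeff, innerCos, mul_left_comm, ← intervalIntegral.integral_const_mul]
  congr 2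
  funext θ
  ring

theorem sum_powCoeff_mul_taylorJ {e : ℕ} (he : e ≤ 1) (N m K : ℕ) (hK : N ≤ K) :
    ∑ k ∈ Finset.range (K + 1), powCoeff e N k * taylorJ e m k = if N = m then 1 else 0 := by
  induction N generalizing m K with
  | zero =>
    rw [Finset.sum_range_succ', powCoeff_zero, if_pos rfl,
      Finset.sum_eq_zero fun k _ => by rw [powCoeff_eq_zero e (by omega), zero_mul]]
    rcases m with _ | m
    · simp [taylorJ]
    · simp [taylorJ_eq_zero]
  | succ N ih =>
    have h := sum_secondDiff_mul (c := 1 + e) (powCoeff e N) (taylorJ e m) K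
    rw [powCoeff_eq_zero e (show N < K + 1 by omega), powCoeff_eq_zero e (show N < K by omega)] at h
    rw [Finset.sum_range_succ', powCoeff_succ_zero he]
    simp only [powCoeff_succ_succ]
    rw [add_comm, sub_eq_zero.1 (h.trans (by simp))]
    rcases m with _ | m
    · have h0 : (taylorJ e 0 1 - (1 + e) * taylorJ e 0 0) / 2 = 0 := by
        interval_cases e <;> norm_num [taylorJ]
      have h1 : ∀ k, (taylorJ e 0 (k + 2) + taylorJ e 0 k) / 2 - taylorJ e 0 (k + 1) = 0 := by
        intro k
        interval_cases e
        · norm_num [taylorJ]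
        · simp only [taylorJ, pow_zero, add_zero, mul_zero, zero_add, Nat.choose_one_right]
          push_cast
          ring
      simp [h0, h1]
    · simp only [taylorJ_succ, taylorJ_succ_zero]
      have := ih m K (by omega)
      rw [Finset.sum_range_succ', add_comm] at this
      rw [this]
      simp

theorem hasSum_powCoeff_mul_taylorJ {e : ℕ} (he : e ≤ 1) (N m : ℕ) :
    HasSum (fun k => powCoeff e N k * taylorJ e m k) (if N = m then 1 else 0) := by
  rw [← sum_powCoeff_mul_taylorJ he N m N le_rfl]
  refine hasSum_sum_of_ne_finset_zero fun k hk => ?_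
  rw [powCoeff_eq_zero e (by simpa using hk), zero_mul]

theorem summable_expCoeff_mul_taylorJ {γ : ℝ} (hγ : 0 ≤ γ) (e p m : ℕ) :
    Summable fun q : ℕ × ℕ =>
      γ ^ q.1 / (q.1.factorial : ℝ) * powCoeff e (q.1 + p) q.2 * taylorJ e m q.2 := by
  have hb : Summable fun q : ℕ × ℕ =>
      (γ ^ q.1 / (q.1.factorial : ℝ) * 8 ^ (q.1 + p)) * (2 * 2 ^ (e + 2 * m) * (1 / 2) ^ q.2) :=
    (hasSum_exp_mul_pow γ 8 p).summable.mul_of_nonneg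
      (summable_geometric_two.mul_left (2 * 2 ^ (e + 2 * m))) (fun N => by positivity)
      (fun k => by positivity)
  refine hb.of_norm_bounded fun ⟨N, k⟩ => ?_
  have h0 : 0 ≤ γ ^ N / (N.factorial : ℝ) := by positivity
  rcases lt_or_ge (N + p) k with hk | hk
  · simp only [powCoeff_eq_zero e hk, mul_zero, zero_mul, norm_zero]
    positivity
  · have h2 : (2 : ℝ) ^ k ≤ 4 ^ (N + p) * (1 / 2) ^ k := by
      have h4 : (4 : ℝ) ^ k ≤ 4 ^ (N + p) := pow_le_pow_right₀ (by norm_num) hk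
      calc (2 : ℝ) ^ k = 4 ^ k * (1 / 2) ^ k := by rw [← mul_pow]; norm_num
        _ ≤ _ := by gcongr
    have h8 : (8 : ℝ) ^ (N + p) = 2 ^ (N + p) * 4 ^ (N + p) := by rw [← mul_pow]; norm_num
    rw [norm_mul, norm_mul, norm_of_nonneg h0, norm_eq_abs, norm_eq_abs]
    calc _ ≤ γ ^ N / (N.factorial : ℝ) * (2 * 2 ^ (N + p)) *
          (2 ^ (e + 2 * m) * (4 ^ (N + p) * (1 / 2) ^ k)) := by
          gcongr
          · exact abs_powCoeff_le e (N + p) k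
          · exact (abs_taylorJ_le e m k).trans (by gcongr)
      _ = _ := by rw [h8]; ring

theorem hasSum_innerCos_exp_mul_taylorJ {γ : ℝ} (hγ : 0 ≤ γ) {e : ℕ} (he : e ≤ 1) (p m : ℕ) :
    HasSum (fun k => innerCos e k (fun x => (x - 1) ^ p * exp (γ * (x - 1))) * taylorJ e m k)
      (if p ≤ m then γ ^ (m - p) / ((m - p).factorial : ℝ) else 0) := by
  have hF := (summable_expCoeff_mul_taylorJ hγ e p m).hasSum
  have hrow := hF.prod_fiberwise fun N => by
    simpa only [mul_assoc] using
      (hasSum_powCoeff_mul_taylorJ he (N + p) m).mul_left (γ ^ N / (N.factorial : ℝ))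
  have hcol := ((Equiv.prodComm ℕ ℕ).hasSum_iff.2 hF).prod_fiberwise fun k =>
    (hasSum_innerCos_exp hγ e p k).mul_right (taylorJ e m k)
  convert! hcol using 1
  refine HasSum.unique ?_ hrow
  split_ifs with h
  · have hs := hasSum_single (f := fun N : ℕ =>
      γ ^ N / (N.factorial : ℝ) * if N + p = m then 1 else 0) (m - p) fun N hN => by
        rw [if_neg (by omega), mul_zero]
    rwa [if_pos (by omega), mul_one] at hs
  · convert! hasSum_zero using 2 with N
    rw [if_neg (by omega), mul_zero]

theorem det_expTaylor (γ : ℝ) (r : ℕ) :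
    Matrix.det (Matrix.of fun i m : Fin r =>
      if r - 1 - (i : ℕ) ≤ r - 1 - (m : ℕ) then
        γ ^ (r - 1 - (m : ℕ) - (r - 1 - (i : ℕ))) /
          ((r - 1 - (m : ℕ) - (r - 1 - (i : ℕ))).factorial : ℝ)
      else 0) = 1 := by
  rw [Matrix.det_of_isLowerTriangular]
  · refine Finset.prod_eq_one fun i _ => ?_
    rw [Matrix.of_apply, if_pos le_rfl]
    simp
  · intro i j hij
    have h1 : (i : ℕ) < j := hij
    have := j.2
    simp only [Matrix.of_apply]
    rw [if_neg (by omega)]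

/-- The parity of the symplectic group: `1` if `n` is even and `0` if `n` is odd. -/
def evenInd (n : ℕ) : ℕ := if Even n then 1 else 0

theorem evenInd_le_one (n : ℕ) : evenInd n ≤ 1 := by
  unfold evenInd
  split_ifs <;> omega

theorem alph_eq (n : ℕ) : alph n = (evenInd n : ℝ) - 1 / 2 := by
  unfold alph evenInd
  split_ifs <;> norm_num

theorem dimSp_eq (n : ℕ) (l : Fin (rr n) → ℕ) :
    dimSp n l = (∏ i : Fin (rr n), ∏ j ∈ Finset.Ioi i,
      (((staircase l j : ℝ) + (1 + evenInd n) / 2) ^ 2 -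
        ((staircase l i : ℝ) + (1 + evenInd n) / 2) ^ 2) /
      ((((rr n - 1 - (j : ℕ) : ℕ) : ℝ) + (1 + evenInd n) / 2) ^ 2 -
        (((rr n - 1 - (i : ℕ) : ℕ) : ℝ) + (1 + evenInd n) / 2) ^ 2)) *
      ∏ j : Fin (rr n), ((staircase l j : ℝ) + 1) ^ evenInd n /
        (((rr n - 1 - (j : ℕ) : ℕ) : ℝ) + 1) ^ evenInd n := by
  have hM : ∀ j : Fin (rr n), ((rr n - 1 - (j : ℕ) : ℕ) : ℝ) = (rr n : ℝ) - (j : ℕ) - 1 := by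
    intro j
    have := j.2
    rw [Nat.sub_sub, Nat.cast_sub (by omega)]
    push_cast
    ring
  have hL : ∀ j : Fin (rr n), (staircase l j : ℝ) = (l j : ℝ) + rr n - (j : ℕ) - 1 := by
    intro j
    rw [staircase, Nat.cast_add, hM]
    ring
  simp only [hM, hL, dimSp, evenInd]
  split_ifs
  · congr 1
    · refine Finset.prod_congr rfl fun i _ => Finset.prod_congr rfl fun j _ => ?_
      rw [← neg_div_neg_eq]
      push_cast
      ring_nf
    · refine Finset.prod_congr rfl fun i _ => ?_
      ring_nf
  · simp only [pow_zero, div_one, Finset.prod_const_one, mul_one]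
    refine Finset.prod_congr rfl fun i _ => Finset.prod_congr rfl fun j _ => ?_
    rw [← neg_div_neg_eq]
    push_cast
    ring_nf

theorem det_taylorJ_staircase (n : ℕ) (l : Fin (rr n) → ℕ) :
    Matrix.det (Matrix.of fun i j : Fin (rr n) =>
      taylorJ (evenInd n) (rr n - 1 - (i : ℕ)) (staircase l j)) =
      2 ^ (rr n * (rr n - 1) / 2) * dimSp n l := by
  obtain ⟨c, hc⟩ := exists_det_taylorJ_eq (evenInd_le_one n) (rr n)
  have h0 := hc fun j => rr n - 1 - (j : ℕ)
  rw [det_taylorJ_staircase_zero] at h0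
  have hne : (2 : ℝ) ^ (rr n * (rr n - 1) / 2) ≠ 0 := by positivity
  rw [h0] at hne ⊢
  rw [hc, dimSp_eq]
  simp only [Finset.prod_div_distrib]
  have h1 := left_ne_zero_of_mul (right_ne_zero_of_mul hne)
  have h2 := right_ne_zero_of_mul (right_ne_zero_of_mul hne)
  rw [div_mul_div_comm, mul_assoc c, mul_div_cancel₀ _ (mul_ne_zero h1 h2)]

/-- Unit mass of the symplectic Plancherel measure `P^γ_n` on `𝕁_n`:
`∑_{λ ∈ 𝕁_n} 2^{r_n(r_n−1)/2}·det[⟨J_{λ̃_j,α_n},(x−1)^{r_n−i}·e^{γ(x−1)}⟩_{α_n}]·dim_n λ = 1`. -/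
theorem plancherel_unit_mass (γ : ℝ) (hγ : 0 ≤ γ) (n : ℕ) (hn : 1 ≤ n) :
    HasSum
      (fun lam : { l : Fin (rr n) → ℕ // Antitone l } =>
        (2 : ℝ) ^ (rr n * (rr n - 1) / 2) *
          Matrix.det (Matrix.of fun i j : Fin (rr n) =>
            innerJ (alph n) (chebJ (alph n) (lam.1 j + (rr n - 1 - (j : ℕ))))
              (fun x => (x - 1) ^ (rr n - 1 - (i : ℕ)) * Real.exp (γ * (x - 1)))) *
          dimSp n lam.1)
      1 := by
  have h := hasSum_det_mul_det
    (fun (i : Fin (rr n)) k => innerCos (evenInd n) k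
      fun x => (x - 1) ^ (rr n - 1 - (i : ℕ)) * exp (γ * (x - 1)))
    (fun (i : Fin (rr n)) k => taylorJ (evenInd n) (rr n - 1 - (i : ℕ)) k) _
    fun i m => hasSum_innerCos_exp_mul_taylorJ hγ (evenInd_le_one n) _ _
  rw [det_expTaylor] at h
  convert! h using 2 with l
  simp only [det_taylorJ_staircase, alph_eq, innerJ_eq_innerCos (evenInd_le_one n)]
  rw [mul_right_comm, mul_comm]
  rfl
end
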